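/- arXiv:2512.12316 — 3 statements merged into one kernel-verified Lean document; each statement's English description precedes it below -/
import Mathlib

section
/- Let e ≥ 1 be an integer and let F₁, F₂ ∈ ℂ[X,Y,Z] be homogeneous polynomials of degree e whose common zero set W in ℙ² consists of exactly e² distinct points. Then every homogeneous polynomial of degree at most e − 1 in ℂ[X,Y,Z] vanishing at every point of W is zero. -/
open MvPolynomial

noncomputable section

/-- The complex projective plane. -/
abbrev P2 : Type := Projectivization ℂ (Fin 3 → ℂ)

/-- A (homogeneous) polynomial `G` vanishes at a point `p ∈ ℙ²`. -/
def VanAt (G : MvPolynomial (Fin 3) ℂ) (p : P2) : Prop :=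
  eval p.rep G = 0

/-- The submodule of polynomials vanishing at every point of `S`. -/
def vanishing (S : Set P2) : Submodule ℂ (MvPolynomial (Fin 3) ℂ) where
  carrier := {G | ∀ p ∈ S, VanAt G p}
  add_mem' := by
    intro a b ha hb p hp
    have h1 := ha p hp
    have h2 := hb p hp
    simp only [VanAt] at h1 h2 ⊢
    simp [h1, h2]
  zero_mem' := by
    intro p hp
    simp [VanAt]
  smul_mem' := by
    intro c G hG p hp
    have h1 := hG p hp
    simp only [VanAt] at h1 ⊢
    simp [h1]

/-- `V_k(S)`: homogeneous polynomials of degree `k` (together with `0`)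
vanishing at every point of `S`. -/
def Vsp (k : ℕ) (S : Set P2) : Submodule ℂ (MvPolynomial (Fin 3) ℂ) :=
  homogeneousSubmodule (Fin 3) ℂ k ⊓ vanishing S

/-- `p` is a singular point of the curve `F = 0`. -/
def SingPt (F : MvPolynomial (Fin 3) ℂ) (p : P2) : Prop :=
  ∀ i : Fin 3, eval p.rep (pderiv i F) = 0

/-- `p` is a node of the curve `F = 0`. -/
def IsNode (F : MvPolynomial (Fin 3) ℂ) (p : P2) : Prop :=
  SingPt F p ∧
    (Matrix.of fun i j : Fin 3 => eval p.rep (pderiv i (pderiv j F))).rank = 2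

/-- The curve `F = 0` is nodal: every singular point is a node. -/
def Nodal (F : MvPolynomial (Fin 3) ℂ) : Prop :=
  ∀ p : P2, SingPt F p → IsNode F p

/-- The set of nodes of the curve `F = 0`. -/
def nodes (F : MvPolynomial (Fin 3) ℂ) : Set P2 :=
  {p | IsNode F p}

/-- The common zero set in `ℙ²` of two polynomials. -/
def zeroSet (F₁ F₂ : MvPolynomial (Fin 3) ℂ) : Set P2 :=
  {p | VanAt F₁ p ∧ VanAt F₂ p}



lemma aux_eval_smul {F : MvPolynomial (Fin 3) ℂ} {n : ℕ} (hF : F.IsHomogeneous n) (c : ℂ)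
    (x : Fin 3 → ℂ) : eval (c • x) F = c ^ n * eval x F := by
  rw [eval_eq, eval_eq, Finset.mul_sum]
  refine Finset.sum_congr rfl fun d hd => ?_
  have h := hF.degree_eq_sum_deg_support hd
  have h2 : ∏ i ∈ d.support, (c • x) i ^ d i = c ^ n * ∏ i ∈ d.support, x i ^ d i := by
    simp only [Pi.smul_apply, smul_eq_mul, mul_pow, Finset.prod_mul_distrib]
    rw [Finset.prod_pow_eq_pow_sum, h]
  rw [h2]; ring

lemma aux_vanAt_mk {F : MvPolynomial (Fin 3) ℂ} {n : ℕ} (hF : F.IsHomogeneous n)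
    (x : Fin 3 → ℂ) (hx : x ≠ 0) : VanAt F (Projectivization.mk ℂ x hx) ↔ eval x F = 0 := by
  obtain ⟨a, ha⟩ := Projectivization.exists_smul_eq_mk_rep ℂ x hx
  unfold VanAt
  rw [← ha]
  change eval ((a : ℂ) • x) F = 0 ↔ _
  rw [aux_eval_smul hF]
  simp

/-- linear form -/
def linF (a : Fin 3 → ℂ) : MvPolynomial (Fin 3) ℂ := ∑ i, C (a i) * X i

lemma linF_hom (a : Fin 3 → ℂ) : (linF a).IsHomogeneous 1 :=
  IsHomogeneous.sum _ _ _ fun i _ => isHomogeneous_C_mul_X _ _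

lemma linF_eval (a x : Fin 3 → ℂ) : eval x (linF a) = a ⬝ᵥ x := by
  simp [linF, dotProduct]

lemma linF_ne {a : Fin 3 → ℂ} (ha : a ≠ 0) : linF a ≠ 0 := by
  intro h
  apply ha
  ext i
  have := linF_eval a (Pi.single i 1)
  rw [h] at this
  simpa using this.symm

/-- a nonzero linear form through two points -/
lemma exists_lin (p q : Fin 3 → ℂ) : ∃ a : Fin 3 → ℂ, a ≠ 0 ∧ a ⬝ᵥ p = 0 ∧ a ⬝ᵥ q = 0 := by
  have hdet : (Matrix.of ![p, q, q]).det = 0 :=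
    Matrix.det_zero_of_row_eq (i := 1) (j := 2) (by decide) rfl
  obtain ⟨v, hv, h⟩ := Matrix.exists_mulVec_eq_zero_iff.2 hdet
  refine ⟨v, hv, ?_, ?_⟩
  · have := congrFun h 0
    rw [dotProduct_comm]; exact this
  · have := congrFun h 1
    rw [dotProduct_comm]; exact this

/-- a linear form separating two distinct points -/
lemma exists_sep (p q : P2) (h : p ≠ q) : ∃ a : Fin 3 → ℂ, a ⬝ᵥ q.rep = 0 ∧ a ⬝ᵥ p.rep ≠ 0 := by
  by_contra hcon
  push Not at hcon
  apply h
  rw [← p.mk_rep, ← q.mk_rep, Projectivization.mk_eq_mk_iff']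
  have hq := q.rep_nonzero
  obtain ⟨j, hj⟩ := Function.ne_iff.1 hq
  refine ⟨p.rep j / q.rep j, ?_⟩
  have hj' : q.rep j ≠ 0 := hj
  ext i
  have := hcon (Pi.single i (q.rep j) - Pi.single j (q.rep i)) (by
    simp [sub_dotProduct]; ring)
  simp [sub_dotProduct] at this
  simp
  field_simp
  linear_combination -this

lemma exists_notMem {S : Set P2} (hS : S.Finite) : ∃ q, q ∉ S := by
  let f : ℂ → P2 := fun t => Projectivization.mk ℂ ![1, t, 0] (by
    intro h; simpa using congrFun h 0)
  have hf : Function.Injective f := by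
    intro s t h
    rw [Projectivization.mk_eq_mk_iff'] at h
    obtain ⟨a, ha⟩ := h
    have h0 := congrFun ha 0
    have h1 := congrFun ha 1
    simp at h0 h1
    rw [h0] at h1
    simpa using h1.symm
  have : Infinite P2 := Infinite.of_injective f hf
  exact hS.exists_notMem

lemma no_common {e : ℕ} {F₁ F₂ : MvPolynomial (Fin 3) ℂ}
    (h1 : F₁.IsHomogeneous e) (h2 : F₂.IsHomogeneous e)
    (hfin : (zeroSet F₁ F₂).Finite) (hne : (zeroSet F₁ F₂).Nonempty)
    {H : MvPolynomial (Fin 3) ℂ} (hH : Prime H) (d1 : H ∣ F₁) (d2 : H ∣ F₂) : False := by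
  obtain ⟨q, hq⟩ := exists_notMem hfin
  choose a ha0 hap haq using fun p : P2 => exists_lin p.rep q.rep
  obtain ⟨s, hs⟩ := hfin.exists_finset
  have hL : (∏ p ∈ s, linF (a p)) ∈
      vanishingIdeal ℂ (zeroLocus ℂ (Ideal.span {H})) := by
    rw [mem_vanishingIdeal_iff]
    intro x hx
    rw [zeroLocus_span] at hx
    have hx : eval x H = 0 := by simpa [aeval_eq_eval] using hx
    change eval x _ = 0
    rw [map_prod]
    by_cases hx0 : x = 0
    · obtain ⟨p, hp⟩ := hne
      refine Finset.prod_eq_zero ((hs p).2 hp) ?_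
      rw [linF_eval, hx0]; simp
    · have e1 : eval x F₁ = 0 := by
        obtain ⟨c, rfl⟩ := d1; simp [hx]
      have e2 : eval x F₂ = 0 := by
        obtain ⟨c, rfl⟩ := d2; simp [hx]
      refine Finset.prod_eq_zero (i := Projectivization.mk ℂ x hx0) ((hs _).2
        ⟨(aux_vanAt_mk h1 x hx0).2 e1, (aux_vanAt_mk h2 x hx0).2 e2⟩) ?_
      apply (aux_vanAt_mk (linF_hom _) x hx0).1
      unfold VanAt
      rw [linF_eval]
      exact hap _
  have : (Ideal.span {H}).IsPrime := (Ideal.span_singleton_prime hH.ne_zero).2 hH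
  rw [IsPrime.vanishingIdeal_zeroLocus, Ideal.mem_span_singleton] at hL
  obtain ⟨p, hp, c, hc⟩ := (hH.dvd_finsetProd_iff _).1 hL
  have hl0 := linF_ne (ha0 p)
  have hdeg := (linF_hom (a p)).totalDegree hl0
  have hc0 : c ≠ 0 := by rintro rfl; simp [hc] at hl0
  rw [hc, totalDegree_mul_of_isDomain hH.ne_zero hc0] at hdeg
  have hHd : H.totalDegree ≠ 0 := by
    intro h0
    rw [totalDegree_eq_zero_iff_eq_C] at h0
    apply hH.not_isUnit
    rw [h0]
    refine (IsUnit.mk0 _ ?_).map C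
    intro h
    rw [h] at h0
    exact hH.ne_zero (by simpa using h0)
  have hcd : c.totalDegree = 0 := by omega
  rw [totalDegree_eq_zero_iff_eq_C] at hcd
  have hev := linF_eval (a p) q.rep
  rw [haq, hc, hcd, map_mul, eval_C] at hev
  have hcc : coeff 0 c ≠ 0 := by
    intro h; rw [h] at hcd; simp at hcd; exact hc0 hcd
  have hHq : eval q.rep H = 0 := by simpa [hcc] using hev
  apply hq
  constructor
  · obtain ⟨c, rfl⟩ := d1; simp [VanAt, hHq]
  · obtain ⟨c, rfl⟩ := d2; simp [VanAt, hHq]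

lemma finrank_hom (d : ℕ) :
    Module.finrank ℂ (homogeneousSubmodule (Fin 3) ℂ d) = (d + 2).choose 2 := by
  rw [homogeneousSubmodule_eq_finsupp_supported]
  rw [(AddMonoidAlgebra.supportedEquivFinsupp (R := ℂ) (S := ℂ)
    {s : Fin 3 →₀ ℕ | s.degree = d}).finrank_eq]
  have hset : {s : Fin 3 →₀ ℕ | s.degree = d} =
      ↑(Finset.finsuppAntidiag (Finset.univ : Finset (Fin 3)) d) := by
    ext s
    simp [Finset.mem_finsuppAntidiag, Finsupp.degree_eq_sum]
  rw [hset, Module.finrank_finsupp_self]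
  simp only [Finset.coe_sort_coe, Fintype.card_coe, Finset.card_finsuppAntidiag_nat_eq_choose]
  simp only [Finset.card_univ, Fintype.card_fin]
  rw [show 3 + d - 1 = d + 2 by omega, Nat.choose_symm_add]

instance finite_hom (d : ℕ) : Module.Finite ℂ (homogeneousSubmodule (Fin 3) ℂ d) :=
  Module.Finite.iff_fg.2 (homogeneousSubmodule_fg (Fin 3) ℂ d)

attribute [local instance] MvPolynomial.gradedAlgebra in
lemma hom_of_mul {F A : MvPolynomial (Fin 3) ℂ} {m k : ℕ} (hF : F.IsHomogeneous m) (hF0 : F ≠ 0)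
    (h : (F * A).IsHomogeneous (m + k)) : A.IsHomogeneous k := by
  have := DirectSum.coe_decompose_mul_add_of_left_mem (homogeneousSubmodule (Fin 3) ℂ)
    (i := m) (j := k) (a := F) (b := A) hF
  rw [DirectSum.decompose_of_mem_same _ h] at this
  have h2 := mul_left_cancel₀ hF0 this
  rw [h2]
  exact (DirectSum.decompose (homogeneousSubmodule (Fin 3) ℂ) A k).2

lemma finrank_Vsp (s : Finset P2) (d : ℕ) (hd : s.card ≤ d) :
    Module.finrank ℂ (Vsp d (s : Set P2)) + s.card ≤ (d + 2).choose 2 := by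
  classical
  let ev : homogeneousSubmodule (Fin 3) ℂ d →ₗ[ℂ] (s → ℂ) :=
    LinearMap.pi fun p => (aeval (R := ℂ) p.1.rep).toLinearMap ∘ₗ Submodule.subtype _
  have hev : ∀ G p, ev G p = eval p.1.rep G.1 := fun G p => rfl
  have hsurj : LinearMap.range ev = ⊤ := by
    rw [eq_top_iff, ← (Pi.basisFun ℂ s).span_eq, Submodule.span_le]
    rintro _ ⟨p, rfl⟩
    have hsep : ∀ q : P2, ∃ a : Fin 3 → ℂ, q ≠ p → a ⬝ᵥ q.rep = 0 ∧ a ⬝ᵥ p.1.rep ≠ 0 := by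
      intro q
      by_cases hq : q = p
      · exact ⟨0, fun h => (h hq).elim⟩
      · obtain ⟨a, ha⟩ := exists_sep p q (Ne.symm hq)
        exact ⟨a, fun _ => ha⟩
    choose a ha using hsep
    obtain ⟨j, hj⟩ := Function.ne_iff.1 p.1.rep_nonzero
    have hj : p.1.rep j ≠ 0 := hj
    have hdegP : (∏ q ∈ s.erase p.1, linF (a q)).IsHomogeneous (s.card - 1) := by
      have := IsHomogeneous.prod (s.erase p.1) (fun q => linF (a q)) (fun _ => 1)
        fun q _ => linF_hom _
      simpa [Finset.card_erase_of_mem p.2] using this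
    have hpos : 0 < s.card := Finset.card_pos.2 ⟨p, p.2⟩
    let P := (∏ q ∈ s.erase p.1, linF (a q)) * X j ^ (d - (s.card - 1))
    have hP : P.IsHomogeneous d := by
      have := hdegP.mul (isHomogeneous_X_pow (R := ℂ) j (d - (s.card - 1)))
      rwa [show s.card - 1 + (d - (s.card - 1)) = d by omega] at this
    have hPp : eval p.1.rep P ≠ 0 := by
      simp only [P, map_mul, map_prod, map_pow, eval_X, linF_eval]
      refine mul_ne_zero (Finset.prod_ne_zero_iff.2 fun q hq => ?_) (pow_ne_zero _ hj)
      exact (ha q (Finset.ne_of_mem_erase hq)).2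
    have hPq : ∀ q : s, q ≠ p → eval q.1.rep P = 0 := by
      intro q hq
      have hq' : q.1 ≠ p.1 := fun h => hq (Subtype.ext h)
      simp only [P, map_mul, map_prod, linF_eval]
      rw [Finset.prod_eq_zero (Finset.mem_erase.2 ⟨hq', q.2⟩) (ha q hq').1, zero_mul]
    refine ⟨(eval p.1.rep P)⁻¹ • ⟨P, hP⟩, ?_⟩
    ext q
    rw [map_smul, Pi.smul_apply, hev, Pi.basisFun_apply]
    by_cases hq : q = p
    · subst hq; simp [hPp]
    · simp [hPq q hq, Pi.single_eq_of_ne hq]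
  have hrn := ev.finrank_range_add_finrank_ker
  rw [hsurj, finrank_top, finrank_hom] at hrn
  have hker : Module.finrank ℂ (Vsp d (s : Set P2)) = Module.finrank ℂ (LinearMap.ker ev) := by
    have : Vsp d (s : Set P2) = (LinearMap.ker ev).map (Submodule.subtype _) := by
      ext G
      simp only [Submodule.mem_map, LinearMap.mem_ker]
      constructor
      · rintro ⟨hG, hv⟩
        refine ⟨⟨G, hG⟩, funext fun p => ?_, rfl⟩
        rw [hev]
        exact hv p.1 p.2
      · rintro ⟨G, hG, rfl⟩
        refine ⟨G.2, fun p hp => ?_⟩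
        have h := hev G ⟨p, hp⟩
        rw [hG] at h
        exact h.symm
    rw [this]
    exact (LinearEquiv.finrank_eq (Submodule.equivMapOfInjective _ (Submodule.subtype_injective _) _)).symm
  rw [hker]
  simp at hrn
  omega

lemma weak_bezout {m n : ℕ} {F G : MvPolynomial (Fin 3) ℂ}
    (hF : F.IsHomogeneous m) (hG : G.IsHomogeneous n) (hF0 : F ≠ 0) (hG0 : G ≠ 0)
    (hrel : IsRelPrime F G) (s : Finset P2) (hsF : ∀ p ∈ s, VanAt F p) (hsG : ∀ p ∈ s, VanAt G p) :
    s.card ≤ m * n := by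
  let c := s.card
  let mulL (A : MvPolynomial (Fin 3) ℂ) := LinearMap.mulLeft ℂ A
  have hinj : ∀ A : MvPolynomial (Fin 3) ℂ, A ≠ 0 → Function.Injective (mulL A) :=
    fun A hA => mul_right_injective₀ hA
  let U := (homogeneousSubmodule (Fin 3) ℂ (c + n)).map (mulL F)
  let V := (homogeneousSubmodule (Fin 3) ℂ (c + m)).map (mulL G)
  let T := (homogeneousSubmodule (Fin 3) ℂ c).map (mulL (G * F))
  have fU : Module.finrank ℂ U = (c + n + 2).choose 2 := by
    rw [← finrank_hom]; exact (LinearEquiv.finrank_eq (Submodule.equivMapOfInjective _ (hinj F hF0) _)).symm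
  have fV : Module.finrank ℂ V = (c + m + 2).choose 2 := by
    rw [← finrank_hom]; exact (LinearEquiv.finrank_eq (Submodule.equivMapOfInjective _ (hinj G hG0) _)).symm
  have fT : Module.finrank ℂ T = (c + 2).choose 2 := by
    rw [← finrank_hom]
    exact (LinearEquiv.finrank_eq (Submodule.equivMapOfInjective _ (hinj _ (mul_ne_zero hG0 hF0)) _)).symm
  have hUV : U ⊓ V ≤ T := by
    rintro _ ⟨⟨A, hA, rfl⟩, ⟨B, hB, hAB⟩⟩
    have hAB : G * B = F * A := hAB
    have hd : F ∣ G * B := ⟨A, hAB⟩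
    obtain ⟨D, rfl⟩ := hrel.dvd_of_dvd_mul_left hd
    refine ⟨D, hom_of_mul hF hF0 (k := c) ?_, ?_⟩
    · rw [add_comm m c]; exact hB
    · change G * F * D = F * A
      rw [← hAB, mul_assoc]
  have hsup : U ⊔ V ≤ Vsp (c + m + n) (s : Set P2) := by
    refine sup_le ?_ ?_
    · rintro _ ⟨A, hA, rfl⟩
      refine ⟨?_, fun p hp => ?_⟩
      · have := hF.mul hA
        rwa [show m + (c + n) = c + m + n by ring] at this
      · have := hsF p hp
        unfold VanAt at this ⊢
        change eval _ (F * A) = 0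
        rw [map_mul, this, zero_mul]
    · rintro _ ⟨A, hA, rfl⟩
      refine ⟨?_, fun p hp => ?_⟩
      · have := hG.mul hA
        rwa [show n + (c + m) = c + m + n by ring] at this
      · have := hsG p hp
        unfold VanAt at this ⊢
        change eval _ (G * A) = 0
        rw [map_mul, this, zero_mul]
  have : Module.Finite ℂ (Vsp (c + m + n) (s : Set P2)) :=
    Submodule.finiteDimensional_inf_left _ _
  have i1 := Submodule.finrank_mono hUV
  have i2 := Submodule.finrank_mono hsup
  have i3 := Submodule.finrank_sup_add_finrank_inf_eq U V
  have i4 := finrank_Vsp s (c + m + n) (by omega)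
  rw [fU, fV] at i3
  rw [fT] at i1
  have key : (c + m + n + 2).choose 2 + (c + 2).choose 2 =
      (c + n + 2).choose 2 + (c + m + 2).choose 2 + m * n := by
    have hq : ∀ k : ℕ, ((k.choose 2 : ℕ) : ℚ) = k * (k - 1) / 2 := Nat.cast_choose_two ℚ
    have : (((c + m + n + 2).choose 2 + (c + 2).choose 2 : ℕ) : ℚ) =
      ((c + n + 2).choose 2 + (c + m + 2).choose 2 + m * n : ℕ) := by
      push_cast [hq]
      ring
    exact_mod_cast this
  omega

lemma exists_pencil {F₁ F₂ G : MvPolynomial (Fin 3) ℂ} (hG : G ≠ 0)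
    (h : ∀ H : MvPolynomial (Fin 3) ℂ, Prime H → H ∣ F₁ → H ∣ F₂ → False) :
    ∃ t : ℂ, IsRelPrime G (F₁ + C t * F₂) := by
  classical
  by_contra hcon
  push Not at hcon
  have hbad : ∀ t : ℂ, ∃ H, Prime H ∧ H ∣ G ∧ H ∣ F₁ + C t * F₂ := by
    intro t
    have := hcon t
    rw [UniqueFactorizationMonoid.isRelPrime_iff_no_prime_factors hG] at this
    push Not at this
    obtain ⟨H, a, b, c⟩ := this
    exact ⟨H, c, a, b⟩
  choose H hp hg hf using hbad
  have hin : ∀ t, ∃ q ∈ UniqueFactorizationMonoid.factors G, Associated (H t) q := fun t =>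
    UniqueFactorizationMonoid.exists_mem_factors_of_dvd hG (hp t).irreducible (hg t)
  choose q hq hass using hin
  have hinj : Function.Injective q := by
    intro s t hst
    by_contra hne
    have d1 := hf s
    have d2 : H s ∣ F₁ + C t * F₂ :=
      (((hass s).trans (hst ▸ (hass t).symm)).dvd).trans (hf t)
    have d3 : H s ∣ C (s - t) * F₂ := by
      have := dvd_sub d1 d2
      rwa [show F₁ + C s * F₂ - (F₁ + C t * F₂) = C (s - t) * F₂ by rw [C_sub]; ring] at this
    have hu : IsUnit (C (s - t) : MvPolynomial (Fin 3) ℂ) :=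
      (IsUnit.mk0 _ (sub_ne_zero.2 hne)).map C
    have d4 : H s ∣ F₂ := hu.dvd_mul_left.1 d3
    exact h _ (hp s) ((dvd_add_left (d4.mul_left _)).1 d1) d4
  have : (Set.range q).Finite :=
    (UniqueFactorizationMonoid.factors G).toFinset.finite_toSet.subset (by
      rintro _ ⟨t, rfl⟩; simpa using hq t)
  exact Set.infinite_range_of_injective hinj this

theorem stmt_1 (e : ℕ) (he : 1 ≤ e) (F₁ F₂ : MvPolynomial (Fin 3) ℂ)
    (h1 : F₁.IsHomogeneous e) (h2 : F₂.IsHomogeneous e)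
    (hfin : (zeroSet F₁ F₂).Finite) (hcard : (zeroSet F₁ F₂).ncard = e ^ 2) :
    ∀ k ≤ e - 1, ∀ G : MvPolynomial (Fin 3) ℂ, G.IsHomogeneous k →
      (∀ p ∈ zeroSet F₁ F₂, VanAt G p) → G = 0 := by
  intro k hk G hG hv
  by_contra hG0
  have hpos : 0 < e ^ 2 := by positivity
  have hne : (zeroSet F₁ F₂).Nonempty := by
    apply Set.nonempty_of_ncard_ne_zero; omega
  obtain ⟨t, ht⟩ := exists_pencil hG0 fun H hH => no_common h1 h2 hfin hne hH
  have hFh : (F₁ + C t * F₂).IsHomogeneous e := h1.add (h2.C_mul t)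
  have hF0 : F₁ + C t * F₂ ≠ 0 := by
    intro h0
    rw [h0, isRelPrime_zero_right] at ht
    obtain ⟨p, hp⟩ := hne
    have := ht.map (eval p.rep)
    rw [hv p hp] at this
    exact not_isUnit_zero this
  have hb := weak_bezout hG hFh hG0 hF0 ht hfin.toFinset
    (fun p hp => hv p (hfin.mem_toFinset.1 hp)) (fun p hp => by
      obtain ⟨a, b⟩ := hfin.mem_toFinset.1 hp
      unfold VanAt at a b ⊢
      simp [a, b])
  rw [← Set.ncard_eq_toFinset_card _ hfin, hcard] at hb
  have : k < e := by omega
  nlinarith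

end
end

section
/- Let e ≥ 1 be an integer and let F₁, F₂ ∈ ℂ[X,Y,Z] be homogeneous polynomials of degree e whose common zero set W in ℙ² consists of exactly e² distinct points. Then W imposes independent conditions on homogeneous forms of degree 2e − 1; that is, dim V_{2e−1}(W) = binom(2e+1, 2) − e² = e² + e. -/
open MvPolynomial

noncomputable section

/-- Restriction to the line `Z = 0`, in the affine coordinate `X / Y`. -/
def resLine : MvPolynomial (Fin 3) ℂ →ₐ[ℂ] Polynomial ℂ :=
  aeval ![Polynomial.X, 1, 0]

lemma resLine_eval (G : MvPolynomial (Fin 3) ℂ) (t : ℂ) :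
    Polynomial.eval t (resLine G) = eval ![t, 1, 0] G := by
  have h : ((Polynomial.aeval t).comp resLine : MvPolynomial (Fin 3) ℂ →ₐ[ℂ] ℂ)
      = aeval ![t, 1, 0] := by
    apply MvPolynomial.algHom_ext
    intro i
    fin_cases i <;> simp [resLine]
  have h' := DFunLike.congr_fun h G
  simpa [MvPolynomial.aeval_eq_eval, Polynomial.coe_aeval_eq_eval] using h'

lemma resLine_eq_sum (G : MvPolynomial (Fin 3) ℂ) :
    resLine G = ∑ m ∈ G.support,
      Polynomial.C (coeff m G) * (Polynomial.X ^ (m 0) * 0 ^ (m 2)) := by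
  rw [resLine, aeval_def, eval₂_eq']
  refine Finset.sum_congr rfl fun m _ => ?_
  simp [Fin.prod_univ_three]

lemma resLine_coeff (G : MvPolynomial (Fin 3) ℂ) (d : ℕ) (hG : G.IsHomogeneous d)
    (m : Fin 3 →₀ ℕ) (hm : m 2 = 0) (hd : m.degree = d) :
    (resLine G).coeff (m 0) = coeff m G := by
  rw [resLine_eq_sum, Polynomial.finsetSum_coeff]
  have h3 : ∀ n : Fin 3 →₀ ℕ, n.degree = n 0 + n 1 + n 2 := by
    intro n
    rw [Finsupp.degree_eq_sum, Fin.sum_univ_three]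
  rw [Finset.sum_eq_single m]
  · simp [hm]
  · intro n hn hne
    rw [Polynomial.coeff_C_mul]
    by_cases h2 : n 2 = 0
    · have hnd : n.degree = d := by
        by_contra hh
        exact (mem_support_iff.mp hn) (hG.coeff_eq_zero hh)
      have : m 0 ≠ n 0 := by
        intro h0
        apply hne
        rw [h3] at hnd hd
        ext i
        fin_cases i <;> simp <;> omega
      simp [h2, Polynomial.coeff_X_pow, this]
    · simp [h2]
  · intro hn
    simp [notMem_support_iff.mp hn]

lemma resLine_natDegree (G : MvPolynomial (Fin 3) ℂ) (d : ℕ) (hG : G.IsHomogeneous d) :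
    (resLine G).natDegree ≤ d := by
  rw [resLine_eq_sum]
  apply Polynomial.natDegree_sum_le_of_forall_le
  intro n hn
  have hnd : n.degree = d := by
    by_contra hh
    exact (mem_support_iff.mp hn) (hG.coeff_eq_zero hh)
  rw [Finsupp.degree_eq_sum, Fin.sum_univ_three] at hnd
  by_cases h2 : n 2 = 0
  · rw [h2, pow_zero, mul_one]
    refine (Polynomial.natDegree_C_mul_X_pow_le _ _).trans ?_
    omega
  · simp [h2]

lemma resLine_top (G : MvPolynomial (Fin 3) ℂ) (d : ℕ) (hG : G.IsHomogeneous d) :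
    (resLine G).coeff d = eval ![1, 0, 0] G := by
  have h := resLine_coeff G d hG (Finsupp.single 0 d) (by simp) (by simp)
  simp only [Finsupp.single_eq_same] at h
  rw [h, eval_eq', Finset.sum_eq_single (Finsupp.single 0 d)]
  · simp [Fin.prod_univ_three]
  · intro n hn hne
    have hnd : n.degree = d := by
      by_contra hh
      exact (mem_support_iff.mp hn) (hG.coeff_eq_zero hh)
    rw [Finsupp.degree_eq_sum, Fin.sum_univ_three] at hnd
    have : ¬ (n 1 = 0 ∧ n 2 = 0) := by
      rintro ⟨ha, hb⟩
      apply hne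
      ext i
      fin_cases i <;> simp <;> omega
    simp only [Fin.prod_univ_three]
    by_cases ha : n 1 = 0
    · have hb : n 2 ≠ 0 := fun hb => this ⟨ha, hb⟩
      simp [hb]
    · simp [ha]
  · intro hn
    simp [notMem_support_iff.mp hn]

/-- A form vanishing on the line `Z = 0` is divisible by `Z`. -/
lemma exists_quot (D : MvPolynomial (Fin 3) ℂ) (d : ℕ) (hD : D.IsHomogeneous (d + 1))
    (h0 : resLine D = 0) : ∃ Q : MvPolynomial (Fin 3) ℂ, Q.IsHomogeneous d ∧ D = X 2 * Q := by
  have hdvd : (X 2 : MvPolynomial (Fin 3) ℂ) ∣ D := by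
    rw [X_dvd_iff_modMonomial_eq_zero]
    ext m
    rw [coeff_zero]
    by_cases hm : m 2 = 0
    · rw [coeff_modMonomial_of_not_le]
      · by_cases hd : m.degree = d + 1
        · rw [← resLine_coeff D (d + 1) hD m hm hd, h0, Polynomial.coeff_zero]
        · exact hD.coeff_eq_zero hd
      · intro hle
        have := hle 2
        simp [hm] at this
    · rw [coeff_modMonomial_of_le]
      rw [Finsupp.single_le_iff]
      omega
  obtain ⟨Q, rfl⟩ := hdvd
  refine ⟨Q, ?_, rfl⟩
  intro m hm
  have h1 : coeff (Finsupp.single 2 1 + m) (X 2 * Q) ≠ 0 := by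
    rwa [coeff_X_mul]
  have h2 := hD h1
  simp only [map_add, Finsupp.weight_single] at h2
  simp at h2
  simpa using by omega

/-- Homogenization in `X, Y`. -/
lemma exists_homog (a : Polynomial ℂ) (d : ℕ) (ha : a.natDegree ≤ d) :
    ∃ A : MvPolynomial (Fin 3) ℂ, A.IsHomogeneous d ∧ resLine A = a := by
  refine ⟨∑ i ∈ Finset.range (d + 1), C (a.coeff i) * (X 0 ^ i * X 1 ^ (d - i)), ?_, ?_⟩
  · apply IsHomogeneous.sum
    intro i hi
    have hi' : i + (d - i) = d := by
      have := Finset.mem_range.mp hi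
      omega
    apply IsHomogeneous.C_mul
    have := (isHomogeneous_X_pow (R := ℂ) (0 : Fin 3) i).mul
      (isHomogeneous_X_pow (R := ℂ) (1 : Fin 3) (d - i))
    rwa [hi'] at this
  · rw [map_sum]
    conv_rhs => rw [a.as_sum_range_C_mul_X_pow' (Nat.lt_succ_of_le ha)]
    refine Finset.sum_congr rfl fun i _ => ?_
    simp [resLine]

lemma bezout_deg (f g h : Polynomial ℂ) (e d : ℕ) (he : 1 ≤ e) (hd : 2 * e ≤ d + 1)
    (hf : f.natDegree = e) (hg : g.natDegree ≤ e) (hh : h.natDegree ≤ d)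
    (hc : IsCoprime f g) :
    ∃ a b : Polynomial ℂ, a.natDegree ≤ d - e ∧ b.natDegree ≤ d - e ∧ a * f + b * g = h := by
  obtain ⟨u, v, huv⟩ := hc
  have hf0 : f ≠ 0 := by
    rintro rfl
    simp at hf
    omega
  set b := (h * v) % f with hb
  set q := (h * v) / f with hq
  have hbq : f * q + b = h * v := EuclideanDomain.div_add_mod _ _
  have hbd : b.natDegree < e := by
    rw [← hf]
    exact Polynomial.natDegree_mod_lt _ (by omega)
  have hid : (h * u + q * g) * f + b * g = h := by
    linear_combination h * huv + g * hbq
  refine ⟨h * u + q * g, b, ?_, by omega, hid⟩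
  by_cases ha : h * u + q * g = 0
  · simp [ha]
  have h1 : ((h * u + q * g) * f).natDegree ≤ d := by
    have : (h * u + q * g) * f = h - b * g := by linear_combination hid
    rw [this]
    refine (Polynomial.natDegree_sub_le _ _).trans (max_le hh ?_)
    refine Polynomial.natDegree_mul_le.trans ?_
    omega
  rw [Polynomial.natDegree_mul ha hf0] at h1
  omega

/-- Every form of degree `d + 1 ≥ 2e - 1` is in `(F₁, F₂) + (Z)`. -/
lemma decomp (e : ℕ) (he : 1 ≤ e) (F₁ F₂ : MvPolynomial (Fin 3) ℂ)
    (h1 : F₁.IsHomogeneous e) (h2 : F₂.IsHomogeneous e)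
    (hno : ∀ x : Fin 3 → ℂ, x 2 = 0 → eval x F₁ = 0 → eval x F₂ = 0 → x = 0)
    (d : ℕ) (hd : 2 * e ≤ d + 2) (G : MvPolynomial (Fin 3) ℂ) (hG : G.IsHomogeneous (d + 1)) :
    ∃ A B Q : MvPolynomial (Fin 3) ℂ, Q.IsHomogeneous d ∧ G = A * F₁ + B * F₂ + X 2 * Q := by
  have hc : IsCoprime (resLine F₁) (resLine F₂) := by
    rw [Polynomial.isCoprime_iff_aeval_ne_zero_of_isAlgClosed ℂ ℂ]
    intro t
    by_contra hcon
    push Not at hcon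
    simp only [Polynomial.coe_aeval_eq_eval, resLine_eval] at hcon
    have := hno _ (by simp) hcon.1 hcon.2
    have := congrFun this 1
    simp at this
  have hab : ∃ a b : Polynomial ℂ, a.natDegree ≤ d + 1 - e ∧ b.natDegree ≤ d + 1 - e ∧
      a * resLine F₁ + b * resLine F₂ = resLine G := by
    by_cases hf : (resLine F₁).natDegree = e
    · exact bezout_deg _ _ _ e (d + 1) he hd hf (resLine_natDegree _ _ h2)
        (resLine_natDegree _ _ hG) hc
    by_cases hg : (resLine F₂).natDegree = e
    · obtain ⟨a, b, ha, hb, hh⟩ := bezout_deg _ _ _ e (d + 1) he hd hg (resLine_natDegree _ _ h1)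
        (resLine_natDegree _ _ hG) hc.symm
      exact ⟨b, a, hb, ha, by rw [← hh, add_comm]⟩
    exfalso
    have hf' := lt_of_le_of_ne (resLine_natDegree _ _ h1) hf
    have hg' := lt_of_le_of_ne (resLine_natDegree _ _ h2) hg
    have hf2 := Polynomial.coeff_eq_zero_of_natDegree_lt hf'
    have hg2 := Polynomial.coeff_eq_zero_of_natDegree_lt hg'
    rw [resLine_top _ _ h1] at hf2
    rw [resLine_top _ _ h2] at hg2
    have := congrFun (hno _ (by simp) hf2 hg2) 0
    simp at this
  obtain ⟨a, b, ha, hb, hh⟩ := hab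
  obtain ⟨A, hA, rfl⟩ := exists_homog a _ ha
  obtain ⟨B, hB, rfl⟩ := exists_homog b _ hb
  have hde : d + 1 - e + e = d + 1 := by omega
  have hA1 := hA.mul h1
  have hB2 := hB.mul h2
  rw [hde] at hA1 hB2
  obtain ⟨Q, hQ, hQe⟩ := exists_quot (G - (A * F₁ + B * F₂)) d (hG.sub (hA1.add hB2))
    (by rw [map_sub, map_add, map_mul, map_mul, hh, sub_self])
  exact ⟨A, B, Q, hQ, by rw [← hQe]; ring⟩

/-- In large degree, forms separate points. -/
lemma surj_large {ι : Type*} [Fintype ι] (w : ι → Fin 3 → ℂ)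
    (hz : ∀ i, w i 2 ≠ 0) (hw : ∀ i j, i ≠ j → ∀ c : ℂ, w i ≠ c • w j)
    (k : ℕ) (hk : Fintype.card ι ≤ k) (v : ι → ℂ) :
    ∃ G : MvPolynomial (Fin 3) ℂ, G.IsHomogeneous k ∧ ∀ i, eval (w i) G = v i := by
  classical
  have hl : ∀ i j, ∃ l : MvPolynomial (Fin 3) ℂ, l.IsHomogeneous 1 ∧
      (i ≠ j → eval (w j) l = 0) ∧ eval (w i) l ≠ 0 := by
    intro i j
    by_cases hij : i = j
    · exact ⟨X 2, isHomogeneous_X _ _, fun h => absurd hij h, by simpa using hz i⟩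
    by_contra hcon
    push Not at hcon
    have key : ∀ a : Fin 3, w j 2 * w i a - w j a * w i 2 = 0 := by
      intro a
      have := hcon (C (w j 2) * X a - C (w j a) * X 2)
        ((isHomogeneous_C_mul_X _ _).sub (isHomogeneous_C_mul_X _ _))
        (fun _ => by simp; ring)
      simpa using this
    apply hw i j hij (w i 2 / w j 2)
    ext a
    have hj := hz j
    have := key a
    simp only [Pi.smul_apply, smul_eq_mul]
    field_simp
    linear_combination this
  choose l hl1 hl2 hl3 using hl
  let P : ι → MvPolynomial (Fin 3) ℂ := fun i =>
    (∏ j, l i j) * X 2 ^ (k - Fintype.card ι)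
  have hP : ∀ i, (P i).IsHomogeneous k := by
    intro i
    have := (IsHomogeneous.prod Finset.univ (l i) (fun _ => 1) (fun j _ => hl1 i j)).mul
      (isHomogeneous_X_pow (R := ℂ) (2 : Fin 3) (k - Fintype.card ι))
    have hc : (∑ _j : ι, 1) + (k - Fintype.card ι) = k := by
      simp
      omega
    rwa [hc] at this
  have hP0 : ∀ i j, i ≠ j → eval (w j) (P i) = 0 := by
    intro i j hij
    simp only [P, map_mul, map_prod]
    rw [Finset.prod_eq_zero (Finset.mem_univ j) (hl2 i j hij), zero_mul]
  have hP1 : ∀ i, eval (w i) (P i) ≠ 0 := by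
    intro i
    simp only [P, map_mul, map_prod, map_pow, eval_X]
    exact mul_ne_zero (Finset.prod_ne_zero_iff.mpr fun j _ => hl3 i j) (pow_ne_zero _ (hz i))
  refine ⟨∑ i, C (v i / eval (w i) (P i)) * P i, ?_, ?_⟩
  · exact IsHomogeneous.sum _ _ _ fun i _ => (hP i).C_mul _
  · intro i
    rw [map_sum, Finset.sum_eq_single i]
    · rw [map_mul, eval_C, div_mul_cancel₀ _ (hP1 i)]
    · intro j _ hji
      rw [map_mul, hP0 j i hji, mul_zero]
    · intro h
      exact absurd (Finset.mem_univ i) h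

lemma surj_core {ι : Type*} [Fintype ι] (w : ι → Fin 3 → ℂ)
    (hz : ∀ i, w i 2 ≠ 0) (hw : ∀ i j, i ≠ j → ∀ c : ℂ, w i ≠ c • w j)
    (e : ℕ) (he : 1 ≤ e) (F₁ F₂ : MvPolynomial (Fin 3) ℂ)
    (h1 : F₁.IsHomogeneous e) (h2 : F₂.IsHomogeneous e)
    (hF₁ : ∀ i, eval (w i) F₁ = 0) (hF₂ : ∀ i, eval (w i) F₂ = 0)
    (hno : ∀ x : Fin 3 → ℂ, x 2 = 0 → eval x F₁ = 0 → eval x F₂ = 0 → x = 0)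
    (k : ℕ) (hk : 2 * e ≤ k + 2) (v : ι → ℂ) :
    ∃ G : MvPolynomial (Fin 3) ℂ, G.IsHomogeneous k ∧ ∀ i, eval (w i) G = v i := by
  have main : ∀ n k : ℕ, 2 * e ≤ k + 2 → Fintype.card ι ≤ k + n → ∀ v : ι → ℂ,
      ∃ G : MvPolynomial (Fin 3) ℂ, G.IsHomogeneous k ∧ ∀ i, eval (w i) G = v i := by
    intro n
    induction n with
    | zero => exact fun k _ hc v => surj_large w hz hw k hc v
    | succ n ih =>
      intro k hk hc v
      obtain ⟨G, hG, hGv⟩ := ih (k + 1) (by omega) (by omega) (fun i => w i 2 * v i)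
      obtain ⟨A, B, Q, hQ, rfl⟩ := decomp e he F₁ F₂ h1 h2 hno k hk G hG
      refine ⟨Q, hQ, fun i => ?_⟩
      have := hGv i
      simp [hF₁, hF₂] at this
      rcases this with h | h
      · exact h
      · exact absurd h (hz i)
  exact main (Fintype.card ι) k hk (by omega) v

/-- A shear moving the points off the line `Z = 0`. -/
def shear (t : ℂ) (x : Fin 3 → ℂ) : Fin 3 → ℂ := ![x 0, x 1, x 2 + t * x 1 + t ^ 2 * x 0]

def unshear (t : ℂ) (x : Fin 3 → ℂ) : Fin 3 → ℂ := ![x 0, x 1, x 2 - t * x 1 - t ^ 2 * x 0]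

lemma unshear_shear (t : ℂ) (x : Fin 3 → ℂ) : unshear t (shear t x) = x := by
  ext i; fin_cases i <;> simp [shear, unshear]; ring

lemma shear_unshear (t : ℂ) (x : Fin 3 → ℂ) : shear t (unshear t x) = x := by
  ext i; fin_cases i <;> simp [shear, unshear]; ring

lemma shear_smul (t c : ℂ) (x : Fin 3 → ℂ) : shear t (c • x) = c • shear t x := by
  ext i; fin_cases i <;> simp [shear]; ring

/-- Substitution by the linear form triple. -/
lemma exists_sub (t s : ℂ) (G : MvPolynomial (Fin 3) ℂ) (d : ℕ) (hG : G.IsHomogeneous d) :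
    ∃ H : MvPolynomial (Fin 3) ℂ, H.IsHomogeneous d ∧
      ∀ x : Fin 3 → ℂ, eval x H = eval ![x 0, x 1, x 2 + t * x 1 + s * x 0] G := by
  refine ⟨aeval ![X 0, X 1, X 2 + C t * X 1 + C s * X 0] G, ?_, ?_⟩
  · have := hG.aeval (S := ℂ) (τ := Fin 3) ![X 0, X 1, X 2 + C t * X 1 + C s * X 0] (n := 1) (by
      intro i
      fin_cases i
      · exact isHomogeneous_X _ _
      · exact isHomogeneous_X _ _
      · exact ((isHomogeneous_X _ _).add (isHomogeneous_C_mul_X _ _)).add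
          (isHomogeneous_C_mul_X _ _))
    simpa using this
  · intro x
    have h : ((aeval x).comp (aeval ![X 0, X 1, X 2 + C t * X 1 + C s * X 0]) :
        MvPolynomial (Fin 3) ℂ →ₐ[ℂ] ℂ) = aeval ![x 0, x 1, x 2 + t * x 1 + s * x 0] := by
      apply MvPolynomial.algHom_ext
      intro i
      fin_cases i <;> simp
    have h' := DFunLike.congr_fun h G
    simpa [MvPolynomial.aeval_eq_eval] using h'

lemma exists_t {ι : Type*} [Fintype ι] (w : ι → Fin 3 → ℂ) (h0 : ∀ i, w i ≠ 0) :
    ∃ t : ℂ, ∀ i, w i 2 + t * w i 1 + t ^ 2 * w i 0 ≠ 0 := by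
  let p : ι → Polynomial ℂ := fun i => Polynomial.C (w i 2) + Polynomial.C (w i 1) * Polynomial.X
    + Polynomial.C (w i 0) * Polynomial.X ^ 2
  have hp : ∀ i, p i ≠ 0 := by
    intro i hi
    apply h0 i
    ext a
    have c0 := congrArg (fun q => Polynomial.coeff q 0) hi
    have c1 := congrArg (fun q => Polynomial.coeff q 1) hi
    have c2 := congrArg (fun q => Polynomial.coeff q 2) hi
    simp [p, Polynomial.coeff_X, Polynomial.coeff_C] at c0 c1 c2
    fin_cases a <;> simp [c0, c1, c2]
  have hprod : (∏ i, p i) ≠ 0 := Finset.prod_ne_zero_iff.mpr fun i _ => hp i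
  obtain ⟨t, ht⟩ := Polynomial.exists_eval_ne_zero_of_natDegree_lt_card (∏ i, p i) hprod
    (by simpa using Cardinal.natCast_lt_aleph0.trans_le (Cardinal.aleph0_le_mk ℂ))
  refine ⟨t, fun i hi => ht ?_⟩
  rw [Polynomial.eval_prod]
  refine Finset.prod_eq_zero (Finset.mem_univ i) ?_
  simp [p]
  linear_combination hi

lemma surj_general {ι : Type*} [Fintype ι] (w : ι → Fin 3 → ℂ) (h0 : ∀ i, w i ≠ 0)
    (hw : ∀ i j, i ≠ j → ∀ c : ℂ, w i ≠ c • w j)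
    (e : ℕ) (he : 1 ≤ e) (F₁ F₂ : MvPolynomial (Fin 3) ℂ)
    (h1 : F₁.IsHomogeneous e) (h2 : F₂.IsHomogeneous e)
    (hF₁ : ∀ i, eval (w i) F₁ = 0) (hF₂ : ∀ i, eval (w i) F₂ = 0)
    (hno : ∀ x : Fin 3 → ℂ, x ≠ 0 → eval x F₁ = 0 → eval x F₂ = 0 → ∃ i, ∃ c : ℂ, x = c • w i)
    (k : ℕ) (hk : 2 * e ≤ k + 2) (v : ι → ℂ) :
    ∃ G : MvPolynomial (Fin 3) ℂ, G.IsHomogeneous k ∧ ∀ i, eval (w i) G = v i := by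
  obtain ⟨t, ht⟩ := exists_t w h0
  obtain ⟨H₁, hH₁, hE₁⟩ := exists_sub (-t) (-t ^ 2) F₁ e h1
  obtain ⟨H₂, hH₂, hE₂⟩ := exists_sub (-t) (-t ^ 2) F₂ e h2
  have hun : ∀ x : Fin 3 → ℂ, ![x 0, x 1, x 2 + -t * x 1 + -t ^ 2 * x 0] = unshear t x := by
    intro x
    ext i; fin_cases i <;> simp [unshear]; ring
  simp only [hun] at hE₁ hE₂
  obtain ⟨G, hG, hGv⟩ := surj_core (fun i => shear t (w i)) (by simpa [shear] using ht)
    (by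
      intro i j hij c hc
      apply hw i j hij c
      have hc' : shear t (w i) = c • shear t (w j) := hc
      rw [← shear_smul] at hc'
      have := congrArg (unshear t) hc'
      rwa [unshear_shear, unshear_shear] at this)
    e he H₁ H₂ hH₁ hH₂ (by simp [hE₁, unshear_shear, hF₁]) (by simp [hE₂, unshear_shear, hF₂])
    (by
      intro x hx hx1 hx2
      rw [hE₁] at hx1
      rw [hE₂] at hx2
      by_contra hxn
      have hne : unshear t x ≠ 0 := by
        intro hz
        apply hxn
        rw [← shear_unshear t x, hz]
        ext i; fin_cases i <;> simp [shear]
      obtain ⟨i, c, hic⟩ := hno _ hne hx1 hx2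
      have hxe : x = c • shear t (w i) := by
        rw [← shear_smul, ← hic, shear_unshear]
      have h2' := congrFun hxe 2
      rw [hx] at h2'
      simp [shear] at h2'
      rcases h2' with h | h
      · apply hxn
        rw [hxe, h, zero_smul]
      · exact ht i h)
    k hk v
  obtain ⟨K, hK, hE⟩ := exists_sub t (t ^ 2) G k hG
  refine ⟨K, hK, fun i => ?_⟩
  rw [hE, ← hGv i]
  rfl

lemma finrank_homog (k : ℕ) :
    Module.finrank ℂ (homogeneousSubmodule (Fin 3) ℂ k) = (k + 2).choose 2 := by
  have hs : {d : Fin 3 →₀ ℕ | d.degree = k}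
      = ((Finset.finsuppAntidiag (Finset.univ : Finset (Fin 3)) k : Finset _) : Set (Fin 3 →₀ ℕ)) := by
    ext d
    simp [Finset.mem_finsuppAntidiag, Finsupp.degree_eq_sum]
  rw [homogeneousSubmodule_eq_finsupp_supported, hs]
  rw [(AddMonoidAlgebra.supportedEquivFinsupp _).finrank_eq]
  rw [Module.finrank_finsupp_self]
  simp only [Finset.coe_sort_coe, Fintype.card_coe]
  rw [Finset.card_finsuppAntidiag_nat_eq_choose]
  rw [Finset.card_univ, Fintype.card_fin, show 3 + k - 1 = k + 2 by omega, Nat.choose_symm_add]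

lemma eval_smul_homog (F : MvPolynomial (Fin 3) ℂ) (e : ℕ) (hF : F.IsHomogeneous e)
    (a : ℂ) (x : Fin 3 → ℂ) : eval (a • x) F = a ^ e * eval x F := by
  rw [eval_eq', eval_eq', Finset.mul_sum]
  refine Finset.sum_congr rfl fun m hm => ?_
  have hd : m.degree = e := by
    by_contra hh
    exact (mem_support_iff.mp hm) (hF.coeff_eq_zero hh)
  rw [Finsupp.degree_eq_sum] at hd
  simp only [Pi.smul_apply, smul_eq_mul, mul_pow, Finset.prod_mul_distrib,
    Finset.prod_pow_eq_pow_sum, hd]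
  ring

theorem stmt_2 (e : ℕ) (he : 1 ≤ e) (F₁ F₂ : MvPolynomial (Fin 3) ℂ)
    (h1 : F₁.IsHomogeneous e) (h2 : F₂.IsHomogeneous e)
    (hfin : (zeroSet F₁ F₂).Finite) (hcard : (zeroSet F₁ F₂).ncard = e ^ 2) :
    Module.finrank ℂ (Vsp (2 * e - 1) (zeroSet F₁ F₂)) = e ^ 2 + e := by
  haveI : Fintype (zeroSet F₁ F₂) := hfin.fintype
  let w : zeroSet F₁ F₂ → Fin 3 → ℂ := fun p => p.1.rep
  have hsurj := surj_general w (fun p => p.1.rep_nonzero)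
    (by
      intro p q hpq c hc
      apply hpq
      apply Subtype.ext
      rw [← p.1.mk_rep, ← q.1.mk_rep, Projectivization.mk_eq_mk_iff']
      exact ⟨c, hc.symm⟩)
    e he F₁ F₂ h1 h2 (fun p => p.2.1) (fun p => p.2.2)
    (by
      intro x hx hx1 hx2
      obtain ⟨a, ha⟩ := Projectivization.exists_smul_eq_mk_rep ℂ x hx
      have hev : ∀ F : MvPolynomial (Fin 3) ℂ, F.IsHomogeneous e → eval x F = 0 →
          eval (Projectivization.mk ℂ x hx).rep F = 0 := by
        intro F hF hF0
        rw [← ha, Units.smul_def, eval_smul_homog F e hF, hF0, mul_zero]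
      refine ⟨⟨Projectivization.mk ℂ x hx, hev _ h1 hx1, hev _ h2 hx2⟩, (a⁻¹ : ℂˣ), ?_⟩
      change x = ((a⁻¹ : ℂˣ) : ℂ) • (Projectivization.mk ℂ x hx).rep
      rw [← Units.smul_def, ← ha, inv_smul_smul])
    (2 * e - 1) (by omega)
  let ev : homogeneousSubmodule (Fin 3) ℂ (2 * e - 1) →ₗ[ℂ] (zeroSet F₁ F₂ → ℂ) :=
    (LinearMap.pi fun p => (aeval (w p) : MvPolynomial (Fin 3) ℂ →ₐ[ℂ] ℂ).toLinearMap).comp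
      (Submodule.subtype _)
  have hev : ∀ G p, ev G p = eval (w p) G.1 := by
    intro G p
    simp [ev, MvPolynomial.aeval_eq_eval]
  have hs : Function.Surjective ev := by
    intro v
    obtain ⟨G, hG, hv⟩ := hsurj v
    refine ⟨⟨G, hG⟩, ?_⟩
    ext p
    rw [hev, ← hv p]
  have : Module.Finite ℂ (homogeneousSubmodule (Fin 3) ℂ (2 * e - 1)) :=
    Module.Finite.iff_fg.mpr (homogeneousSubmodule_fg _ _ _)
  have hrn := LinearMap.finrank_range_add_finrank_ker ev
  rw [LinearMap.range_eq_top.mpr hs, finrank_top, Module.finrank_fintype_fun_eq_card,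
    finrank_homog, ← Nat.card_eq_fintype_card, Nat.card_coe_set_eq, hcard] at hrn
  have hker : Vsp (2 * e - 1) (zeroSet F₁ F₂) = (LinearMap.ker ev).map (Submodule.subtype _) := by
    ext G
    constructor
    · rintro ⟨hG, hv⟩
      refine ⟨⟨G, hG⟩, ?_, rfl⟩
      rw [SetLike.mem_coe, LinearMap.mem_ker]
      ext p
      rw [hev]
      exact hv p.1 p.2
    · rintro ⟨G, hG, rfl⟩
      refine ⟨G.2, fun p hp => ?_⟩
      have := congrFun (LinearMap.mem_ker.mp hG) ⟨p, hp⟩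
      rw [hev] at this
      exact this
  rw [hker, LinearEquiv.finrank_eq
    (Submodule.equivMapOfInjective _ (Submodule.injective_subtype _) _).symm]
  have hch : (2 * e - 1 + 2).choose 2 = 2 * e ^ 2 + e := by
    obtain ⟨n, rfl⟩ : ∃ n, e = n + 1 := ⟨e - 1, by omega⟩
    rw [Nat.choose_two_right]
    have : 2 * (n + 1) - 1 + 2 = 2 * n + 3 := by omega
    rw [this]
    apply Nat.div_eq_of_eq_mul_left (by norm_num)
    simp
    ring
  omega

end
end

section
/- Let F ∈ ℂ[X,Y,Z] be an irreducible homogeneous polynomial of degree d ≥ 3 whose curve F = 0 has only nodes as singularities, let Δ ⊆ ℙ² be the (finite) set of nodes, and set n = |Δ|, with n ≤ binom(d−1, 2) − 1. Then there exists a basis F₁, F₂, F₃ of the ℂ-linear span of the partial derivatives F_X, F_Y, F_Z such that for every pair i ≠ j the common zero set of F_i and F_j in ℙ² equals Δ ∪ Σ_{ij}, where Σ_{ij} is a set of exactly (d−1)² − n distinct points and Σ_{ij} ∩ Δ = ∅. -/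
open MvPolynomial

noncomputable section

abbrev T2 : Type := MvPolynomial (Fin 2) ℂ

/-- affine common zeros -/
def affZ (g₁ g₂ : T2) : Set (Fin 2 → ℂ) := {x | eval x g₁ = 0 ∧ eval x g₂ = 0}

def jac2 (g₁ g₂ : T2) : T2 :=
  pderiv 0 g₁ * pderiv 1 g₂ - pderiv 1 g₁ * pderiv 0 g₂

lemma kd_chain {B : Type*} [CommRing B] [Algebra ℂ B] {M : Type*} [AddCommGroup M] [Module ℂ M]
    [Module B M] (D : Derivation ℂ B M) (π : T2 →ₐ[ℂ] B) (p : T2) :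
    D (π p) = π (pderiv 0 p) • D (π (X 0)) + π (pderiv 1 p) • D (π (X 1)) := by
  induction p using MvPolynomial.induction_on with
  | C a =>
    have : π (C a) = algebraMap ℂ B a := π.commutes a
    rw [this]; simp
  | add p q hp hq =>
    simp only [map_add, hp, hq, add_smul]; abel
  | mul_X p i hp =>
    rw [map_mul, Derivation.leibniz, hp]
    fin_cases i
    · simp [Derivation.leibniz]
      module
    · simp [Derivation.leibniz]
      module

lemma unram_aux {B : Type*} [CommRing B] [Algebra ℂ B] (π : T2 →ₐ[ℂ] B)
    (hπ : Function.Surjective π) (g₁ g₂ : T2) (h₁ : π g₁ = 0) (h₂ : π g₂ = 0)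
    (hu : IsUnit (π (jac2 g₁ g₂))) : Algebra.FormallyUnramified ℂ B := by
  constructor
  have e1 := kd_chain (KaehlerDifferential.D ℂ B) π g₁
  have e2 := kd_chain (KaehlerDifferential.D ℂ B) π g₂
  rw [h₁, map_zero] at e1
  rw [h₂, map_zero] at e2
  set dx := KaehlerDifferential.D ℂ B (π (X 0)) with hdx
  set dy := KaehlerDifferential.D ℂ B (π (X 1)) with hdy
  have hx : dx = 0 := by
    rw [← hu.smul_eq_zero]
    have : π (jac2 g₁ g₂) • dx =
      π (pderiv 1 g₂) • (π (pderiv 0 g₁) • dx + π (pderiv 1 g₁) • dy)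
      - π (pderiv 1 g₁) • (π (pderiv 0 g₂) • dx + π (pderiv 1 g₂) • dy) := by
      simp only [jac2, map_sub, map_mul]; module
    rw [this, ← e1, ← e2]; simp
  have hy : dy = 0 := by
    rw [← hu.smul_eq_zero]
    have : π (jac2 g₁ g₂) • dy =
      π (pderiv 0 g₁) • (π (pderiv 0 g₂) • dx + π (pderiv 1 g₂) • dy)
      - π (pderiv 0 g₂) • (π (pderiv 0 g₁) • dx + π (pderiv 1 g₁) • dy) := by
      simp only [jac2, map_sub, map_mul]; module
    rw [this, ← e1, ← e2]; simp
  have ht := KaehlerDifferential.span_range_derivation ℂ B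
  rw [← Submodule.subsingleton_iff B]
  refine subsingleton_of_bot_eq_top ?_
  rw [← ht, eq_comm, Submodule.span_eq_bot]
  rintro _ ⟨b, rfl⟩
  obtain ⟨p, rfl⟩ := hπ b
  rw [kd_chain, ← hdx, ← hdy, hx, hy]; simp

lemma jac_isUnit (g₁ g₂ : T2) (h : ∀ x ∈ affZ g₁ g₂, eval x (jac2 g₁ g₂) ≠ 0) :
    IsUnit (Ideal.Quotient.mk (Ideal.span {g₁, g₂}) (jac2 g₁ g₂)) := by
  by_contra hu
  obtain ⟨M, hM, hmem⟩ := exists_max_ideal_of_mem_nonunits hu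
  have hM' : (M.comap (Ideal.Quotient.mk (Ideal.span {g₁, g₂}))).IsMaximal :=
    Ideal.comap_isMaximal_of_surjective _ Ideal.Quotient.mk_surjective
  obtain ⟨x, hx⟩ := isMaximal_iff_eq_vanishingIdeal_singleton.1 hM'
  have key : ∀ p, Ideal.Quotient.mk (Ideal.span {g₁, g₂}) p ∈ M → eval x p = 0 := by
    intro p hp
    have : p ∈ M.comap (Ideal.Quotient.mk (Ideal.span {g₁, g₂})) := hp
    rw [hx, mem_vanishingIdeal_singleton_iff] at this
    simpa [aeval_eq_eval] using this
  refine h x ⟨key _ ?_, key _ ?_⟩ (key _ hmem)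
  · rw [Ideal.Quotient.eq_zero_iff_mem.2 (Ideal.subset_span (by simp))]; exact M.zero_mem
  · rw [Ideal.Quotient.eq_zero_iff_mem.2 (Ideal.subset_span (by simp))]; exact M.zero_mem

lemma unram (g₁ g₂ : T2) (h : ∀ x ∈ affZ g₁ g₂, eval x (jac2 g₁ g₂) ≠ 0) :
    Algebra.FormallyUnramified ℂ (T2 ⧸ Ideal.span {g₁, g₂}) :=
  unram_aux (Ideal.Quotient.mkₐ ℂ (Ideal.span {g₁, g₂})) (Ideal.Quotient.mkₐ_surjective _ _) g₁ g₂
    (Ideal.Quotient.eq_zero_iff_mem.2 (Ideal.subset_span (by simp)))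
    (Ideal.Quotient.eq_zero_iff_mem.2 (Ideal.subset_span (by simp)))
    (jac_isUnit g₁ g₂ h)

lemma aff_count (g₁ g₂ : T2) (h : ∀ x ∈ affZ g₁ g₂, eval x (jac2 g₁ g₂) ≠ 0) :
    (affZ g₁ g₂).Finite ∧
      (affZ g₁ g₂).ncard = Module.finrank ℂ (T2 ⧸ Ideal.span {g₁, g₂}) := by
  have hur := unram g₁ g₂ h
  set I := Ideal.span {g₁, g₂} with hI
  have hfin : Module.Finite ℂ (T2 ⧸ I) := Algebra.FormallyUnramified.finite_of_free _ _
  have hred : IsReduced (T2 ⧸ I) := Algebra.FormallyUnramified.isReduced_of_field ℂ _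
  have hrad : I.IsRadical := (Ideal.isRadical_iff_quotient_reduced I).2 hred
  have hz : zeroLocus ℂ I = affZ g₁ g₂ := by
    rw [hI, zeroLocus_span]
    ext x; simp [affZ, aeval_eq_eval]
  have hI0 : ∀ x ∈ affZ g₁ g₂, ∀ p ∈ I, eval x p = 0 := by
    intro x hx p hp
    rw [← hz] at hx
    have := hx p hp
    simpa [aeval_eq_eval] using this
  -- evaluation homs
  let ev : affZ g₁ g₂ → ((T2 ⧸ I) →ₐ[ℂ] ℂ) := fun x =>
    Ideal.Quotient.liftₐ I (aeval x.1) (fun p hp => by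
      have := hI0 x.1 x.2 p hp
      simpa [aeval_eq_eval] using this)
  have hev : ∀ x p, ev x (Ideal.Quotient.mk I p) = eval x.1 p := by
    intro x p
    have : ev x (Ideal.Quotient.mk I p) = aeval x.1 p := rfl
    rw [this, aeval_eq_eval]
  have hinj : Function.Injective ev := by
    intro x y hxy
    ext i
    have := DFunLike.congr_fun hxy (Ideal.Quotient.mk I (X i))
    simpa [hev] using this
  have hli : LinearIndependent ℂ (fun x => (ev x).toLinearMap) :=
    (linearIndependent_algHom_toLinearMap ℂ (T2 ⧸ I) ℂ).comp ev hinj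
  have hfz : Finite (affZ g₁ g₂) := hli.finite
  refine ⟨hfz, ?_⟩
  have := Fintype.ofFinite (affZ g₁ g₂)
  rw [← Nat.card_coe_set_eq, Nat.card_eq_fintype_card]
  apply le_antisymm
  · have h1 := hli.fintype_card_le_finrank
    rwa [show Module.finrank ℂ ((T2 ⧸ I) →ₗ[ℂ] ℂ) = Module.finrank ℂ (T2 ⧸ I) from
      Subspace.dual_finrank_eq] at h1
  · let E : (T2 ⧸ I) →ₗ[ℂ] (affZ g₁ g₂ → ℂ) := LinearMap.pi (fun x => (ev x).toLinearMap)
    have hE : Function.Injective E := by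
      rw [← LinearMap.ker_eq_bot, LinearMap.ker_eq_bot']
      intro b hb
      obtain ⟨p, rfl⟩ := Ideal.Quotient.mk_surjective b
      rw [Ideal.Quotient.eq_zero_iff_mem]
      rw [← hrad.radical, ← vanishingIdeal_zeroLocus_eq_radical (K := ℂ), mem_vanishingIdeal_iff]
      intro x hx
      rw [hz] at hx
      have := congrFun hb ⟨x, hx⟩
      have h2 : ev ⟨x, hx⟩ (Ideal.Quotient.mk I p) = 0 := this
      rw [hev] at h2
      rw [aeval_eq_eval]; exact h2
    have := LinearMap.finrank_le_finrank_of_injective hE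
    simpa using this


lemma hc_mul (e f : ℕ) (a b : T2) (ha : a.totalDegree ≤ e) (hb : b.totalDegree ≤ f) :
    homogeneousComponent (e + f) (a * b) = homogeneousComponent e a * homogeneousComponent f b := by
  classical
  ext d
  rw [coeff_homogeneousComponent]
  split_ifs with h
  · rw [coeff_mul, coeff_mul]
    refine Finset.sum_congr rfl ?_
    rintro ⟨x, y⟩ hxy
    rw [Finset.HasAntidiagonal.mem_antidiagonal] at hxy
    simp only at hxy ⊢
    rw [coeff_homogeneousComponent, coeff_homogeneousComponent]
    have hdeg : x.degree + y.degree = e + f := by rw [← h, ← hxy, map_add]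
    by_cases hx : x.degree = e
    · have hy : y.degree = f := by omega
      simp [hx, hy]
    · rw [if_neg hx, zero_mul]
      rcases lt_or_gt_of_ne hx with hlt | hgt
      · have : coeff y b = 0 := coeff_eq_zero_of_totalDegree_lt (by
          have : y.degree = ∑ i ∈ y.support, y i := rfl
          omega)
        rw [this, mul_zero]
      · have : coeff x a = 0 := coeff_eq_zero_of_totalDegree_lt (by
          have : x.degree = ∑ i ∈ x.support, x i := rfl
          omega)
        rw [this, zero_mul]
  · have := ((homogeneousComponent_isHomogeneous e a).mul
      (homogeneousComponent_isHomogeneous f b)).coeff_eq_zero (d := d) h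
    rw [this]

lemma deg_drop (e : ℕ) (a : T2) (ha : a.totalDegree ≤ e + 1) (h : homogeneousComponent (e+1) a = 0) :
    a.totalDegree ≤ e := by
  rw [totalDegree, Finset.sup_le_iff]
  intro d hd
  have h1 : d.degree ≤ e + 1 := (le_totalDegree hd).trans ha
  have h2 : d.degree ≠ e + 1 := by
    intro h3
    have := congrArg (coeff d) h
    rw [coeff_homogeneousComponent, if_pos h3] at this
    rw [mem_support_iff] at hd
    exact hd (by simpa using this)
  have : d.sum (fun _ e => e) = d.degree := rfl
  omega

structure TopData (m : ℕ) (g₁ g₂ t₁ t₂ : T2) : Prop where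
  hm : 1 ≤ m
  d1 : g₁.totalDegree ≤ m
  d2 : g₂.totalDegree ≤ m
  h1 : homogeneousComponent m g₁ = t₁
  h2 : homogeneousComponent m g₂ = t₂
  rel : IsRelPrime t₁ t₂

lemma isUnit_hom_deg {e : ℕ} {h : T2} (hu : IsUnit h) (hh : h.IsHomogeneous e) : e = 0 := by
  have h0 : h ≠ 0 := hu.ne_zero
  rw [isUnit_iff_eq_C_of_isReduced] at hu
  obtain ⟨r, -, rfl⟩ := hu
  exact hh.inj_right (isHomogeneous_C _ _) h0

namespace TopData
variable {m : ℕ} {g₁ g₂ t₁ t₂ : T2}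

lemma symm (H : TopData m g₁ g₂ t₁ t₂) : TopData m g₂ g₁ t₂ t₁ := ⟨H.hm, H.d2, H.d1, H.h2, H.h1, H.rel.symm⟩

lemma t2_ne (H : TopData m g₁ g₂ t₁ t₂) : t₂ ≠ 0 := by
  rintro rfl
  have hu : IsUnit t₁ := H.rel (dvd_refl _) (dvd_zero _)
  have := isUnit_hom_deg hu (H.h1 ▸ homogeneousComponent_isHomogeneous m g₁)
  have := H.hm
  omega

lemma t1_ne (H : TopData m g₁ g₂ t₁ t₂) : t₁ ≠ 0 := H.symm.t2_ne

lemma g1_deg (H : TopData m g₁ g₂ t₁ t₂) : g₁.totalDegree = m := by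
  refine le_antisymm H.d1 ?_
  by_contra h
  push Not at h
  exact H.t1_ne (H.h1 ▸ homogeneousComponent_eq_zero _ _ h)

lemma g1_ne (H : TopData m g₁ g₂ t₁ t₂) : g₁ ≠ 0 := by
  intro h
  have := H.g1_deg
  have := H.hm
  simp [h] at *
  omega

lemma dvd_aux (H : TopData m g₁ g₂ t₁ t₂) {h : T2} (hd : h ∣ g₁) : homogeneousComponent h.totalDegree h ∣ t₁ := by
  obtain ⟨u, rfl⟩ := hd
  have hne := H.g1_ne
  have := H.g1_deg
  rw [totalDegree_mul_of_isDomain (left_ne_zero_of_mul hne) (right_ne_zero_of_mul hne)] at this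
  rw [← H.h1, ← this, hc_mul _ _ _ _ le_rfl le_rfl]
  exact dvd_mul_right _ _

lemma relg (H : TopData m g₁ g₂ t₁ t₂) : IsRelPrime g₁ g₂ := by
  intro h h1 h2
  have hu := H.rel (H.dvd_aux h1) (H.symm.dvd_aux h2)
  have hd := isUnit_hom_deg hu (homogeneousComponent_isHomogeneous _ _)
  have h0 : h ≠ 0 := by rintro rfl; exact H.g1_ne (zero_dvd_iff.1 h1)
  rw [totalDegree_eq_zero_iff_eq_C] at hd
  rw [hd]
  rw [hd] at h0
  refine (isUnit_iff_ne_zero.2 ?_).map C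
  intro hc; rw [hc] at h0; simp at h0

lemma koszul (H : TopData m g₁ g₂ t₁ t₂) {a b : T2} (h : a * g₁ + b * g₂ = 0) : ∃ c, a = c * g₂ ∧ b = - (c * g₁) := by
  have : g₂ ∣ a * g₁ := ⟨-b, by linear_combination h⟩
  obtain ⟨c, rfl⟩ := H.relg.symm.dvd_of_dvd_mul_right this
  refine ⟨c, by ring, ?_⟩
  have h2 : g₂ * (b + c * g₁) = 0 := by linear_combination h
  rcases mul_eq_zero.1 h2 with h3 | h3
  · exact absurd h3 H.symm.g1_ne
  · linear_combination h3

lemma reduce (H : TopData m g₁ g₂ t₁ t₂) (k n : ℕ) : ∀ (a b : T2), a.totalDegree ≤ k + n → b.totalDegree ≤ k + n →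
    (a * g₁ + b * g₂).totalDegree ≤ k + m →
    ∃ c, (a - c * g₂).totalDegree ≤ k ∧ (b + c * g₁).totalDegree ≤ k := by
  induction n with
  | zero => intro a b ha hb _; exact ⟨0, by simpa using ha, by simpa using hb⟩
  | succ n ih =>
    intro a b ha hb hab
    have hz : homogeneousComponent (k + n + 1 + m) (a * g₁ + b * g₂) = 0 :=
      homogeneousComponent_eq_zero _ _ (by omega)
    rw [map_add, hc_mul _ _ _ _ (by omega) H.d1, hc_mul _ _ _ _ (by omega) H.d2, H.h1, H.h2] at hz
    set A := homogeneousComponent (k + n + 1) a with hA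
    set B := homogeneousComponent (k + n + 1) b with hB
    have hAB : ∃ c, c.totalDegree + m ≤ k + n + 1 ∧ A = homogeneousComponent (k+n+1) (c * g₂) ∧
        B = - homogeneousComponent (k+n+1) (c * g₁) ∨ (A = 0 ∧ B = 0) := by
      by_cases hA0 : A = 0
      · refine ⟨0, Or.inr ⟨hA0, ?_⟩⟩
        rw [hA0, zero_mul, zero_add] at hz
        exact (mul_eq_zero.1 hz).resolve_right H.t2_ne
      · have : t₂ ∣ A * t₁ := ⟨-B, by linear_combination hz⟩
        obtain ⟨c, hc⟩ := H.rel.symm.dvd_of_dvd_mul_right this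
        have hc0 : c ≠ 0 := by rintro rfl; exact hA0 (by simpa using hc)
        have hAh : A.IsHomogeneous (k+n+1) := homogeneousComponent_isHomogeneous _ _
        have ht2 : t₂.IsHomogeneous m := H.h2 ▸ homogeneousComponent_isHomogeneous _ _
        have hdeg : k + n + 1 = m + c.totalDegree := by
          rw [← hAh.totalDegree hA0, hc, totalDegree_mul_of_isDomain H.t2_ne hc0,
            ht2.totalDegree H.t2_ne]
        have hBc : B = - (c * t₁) := by
          have h2 : t₂ * (B + c * t₁) = 0 := by rw [hc] at hz; linear_combination hz
          rcases mul_eq_zero.1 h2 with h3 | h3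
          · exact absurd h3 H.t2_ne
          · linear_combination h3
        have hAA : A = homogeneousComponent (k+n+1) A := (homogeneousComponent_eq_self hAh).symm
        have hBB : B = homogeneousComponent (k+n+1) B :=
          (homogeneousComponent_eq_self (homogeneousComponent_isHomogeneous _ _)).symm
        have ht1 : t₁.IsHomogeneous m := H.h1 ▸ homogeneousComponent_isHomogeneous _ _
        have e : k + n + 1 = c.totalDegree + m := by omega
        refine ⟨c, Or.inl ⟨by omega, ?_, ?_⟩⟩
        · rw [hAA, hc, mul_comm, e, hc_mul _ _ _ _ le_rfl H.d2,
            hc_mul _ _ _ _ le_rfl ht2.totalDegree_le, H.h2, homogeneousComponent_eq_self ht2]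
        · rw [hBB, hBc, map_neg, e, hc_mul _ _ _ _ le_rfl H.d1,
            hc_mul _ _ _ _ le_rfl ht1.totalDegree_le, H.h1, homogeneousComponent_eq_self ht1]
    obtain ⟨c, ⟨hcd, hcA, hcB⟩ | ⟨hcA, hcB⟩⟩ := hAB
    · have l1 : (c * g₂).totalDegree ≤ k + n + 1 :=
        (totalDegree_mul _ _).trans (by have := H.d2; omega)
      have l2 : (c * g₁).totalDegree ≤ k + n + 1 :=
        (totalDegree_mul _ _).trans (by have := H.d1; omega)
      obtain ⟨c', h1, h2⟩ := ih (a - c * g₂) (b + c * g₁)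
        (deg_drop _ _ ((totalDegree_sub _ _).trans (max_le ha l1)) (by
          rw [map_sub, ← hcA, ← hA, sub_self]))
        (deg_drop _ _ ((totalDegree_add _ _).trans (max_le hb l2)) (by
          rw [map_add, ← hB, hcB]; ring))
        (by convert hab using 2; ring)
      refine ⟨c + c', ?_, ?_⟩
      · convert h1 using 2; ring
      · convert h2 using 2; ring
    · exact ih a b (deg_drop _ _ ha hcA) (deg_drop _ _ hb hcB) hab

end TopData

lemma finrank_D (k : ℕ) : 2 * Module.finrank ℂ (restrictTotalDegree (Fin 2) ℂ k) = (k + 1) * (k + 2) := by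
  have h := Module.finrank_eq_nat_card_basis
    (basisRestrictSupport ℂ {n : Fin 2 →₀ ℕ | (n.sum fun _ e => e) ≤ k})
  change Module.finrank ℂ (restrictTotalDegree (Fin 2) ℂ k) = _ at h
  rw [h]
  let e : {n : Fin 2 →₀ ℕ | (n.sum fun _ e => e) ≤ k} ≃ (Σ i : Fin (k+1), Fin (i+1)) :=
    { toFun := fun n => ⟨⟨n.1 0 + n.1 1, by
        have := n.2
        simp [Finsupp.sum_fintype] at this
        omega⟩, ⟨n.1 0, by simp⟩⟩
      invFun := fun s => ⟨Finsupp.equivFunOnFinite.symm ![s.2.1, s.1.1 - s.2.1], by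
        have := s.1.2
        have := s.2.2
        simp [Finsupp.sum_fintype]
        omega⟩
      left_inv := by
        rintro ⟨n, hn⟩
        ext i
        fin_cases i <;> simp
      right_inv := by
        rintro ⟨⟨i, hi⟩, ⟨j, hj⟩⟩
        obtain ⟨l, rfl⟩ := Nat.exists_eq_add_of_le (Nat.lt_succ_iff.1 hj)
        refine Sigma.ext (by simp) ?_
        refine (Fin.heq_ext_iff (by simp)).2 ?_
        simp }
  rw [Nat.card_congr e]
  simp only [Nat.card_eq_fintype_card, Fintype.card_sigma, Fintype.card_fin]
  rw [Fin.sum_univ_eq_sum_range (fun i => i + 1) (k + 1)]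
  clear e h
  induction k with
  | zero => simp
  | succ k ih => rw [Finset.sum_range_succ, mul_add, ih]; ring

lemma rank_null {V W : Type*} [AddCommGroup V] [Module ℂ V] [AddCommGroup W] [Module ℂ W]
    (f : V →ₗ[ℂ] W) (p : Submodule ℂ V) [Module.Finite ℂ p] :
    Module.finrank ℂ (p.map f) + Module.finrank ℂ (LinearMap.ker f ⊓ p : Submodule ℂ V) =
      Module.finrank ℂ p := by
  have h := LinearMap.finrank_range_add_finrank_ker (f.domRestrict p)
  rw [LinearMap.range_domRestrict, LinearMap.ker_domRestrict] at h
  rw [← h, ← Submodule.finrank_map_subtype_eq p, Submodule.map_comap_subtype, inf_comm]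

namespace TopData
variable {m : ℕ} {g₁ g₂ t₁ t₂ : T2}



lemma finrank_J (H : TopData m g₁ g₂ t₁ t₂) (k : ℕ) :
    Module.finrank ℂ (LinearMap.ker (Ideal.Quotient.mkₐ ℂ (Ideal.span {g₁, g₂})).toLinearMap ⊓
      restrictTotalDegree (Fin 2) ℂ (k + m + m) : Submodule ℂ T2) + Module.finrank ℂ (restrictTotalDegree (Fin 2) ℂ k) = 2 * Module.finrank ℂ (restrictTotalDegree (Fin 2) ℂ (k + m)) := by
  let Ψ : (T2 × T2) →ₗ[ℂ] T2 :=
    (LinearMap.mulRight ℂ g₁).comp (LinearMap.fst ℂ T2 T2) +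
      (LinearMap.mulRight ℂ g₂).comp (LinearMap.snd ℂ T2 T2)
  have hΨ : ∀ a b, Ψ (a, b) = a * g₁ + b * g₂ := fun a b => rfl
  let Θ : T2 →ₗ[ℂ] (T2 × T2) := (LinearMap.mulRight ℂ g₂).prod (-(LinearMap.mulRight ℂ g₁))
  have hΘ : ∀ c, Θ c = (c * g₂, - (c * g₁)) := fun c => rfl
  have hΘi : Function.Injective Θ := by
    intro c c' h
    rw [hΘ, hΘ, Prod.mk.injEq] at h
    exact mul_right_cancel₀ H.symm.g1_ne h.1
  let P : Submodule ℂ (T2 × T2) := (restrictTotalDegree (Fin 2) ℂ (k + m)).prod (restrictTotalDegree (Fin 2) ℂ (k + m))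
  let eP : P ≃ₗ[ℂ] (restrictTotalDegree (Fin 2) ℂ (k + m)) × (restrictTotalDegree (Fin 2) ℂ (k + m)) :=
    { toFun := fun x => (⟨x.1.1, x.2.1⟩, ⟨x.1.2, x.2.2⟩)
      invFun := fun y => ⟨(y.1.1, y.2.1), y.1.2, y.2.2⟩
      map_add' := fun _ _ => rfl
      map_smul' := fun _ _ => rfl
      left_inv := fun _ => rfl
      right_inv := fun _ => rfl }
  have : Module.Finite ℂ P := Module.Finite.equiv eP.symm
  have hP : Module.finrank ℂ P = 2 * Module.finrank ℂ (restrictTotalDegree (Fin 2) ℂ (k + m)) := by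
    rw [eP.finrank_eq, Module.finrank_prod, two_mul]
  have e1 : P.map Ψ = LinearMap.ker (Ideal.Quotient.mkₐ ℂ (Ideal.span {g₁, g₂})).toLinearMap ⊓
      restrictTotalDegree (Fin 2) ℂ (k + m + m) := by
    ext f
    simp only [Submodule.mem_map, Submodule.mem_inf, LinearMap.mem_ker, AlgHom.toLinearMap_apply,
      Ideal.Quotient.mkₐ_eq_mk, Ideal.Quotient.eq_zero_iff_mem, Ideal.mem_span_pair,
      mem_restrictTotalDegree]
    constructor
    · rintro ⟨⟨a, b⟩, hab, rfl⟩
      obtain ⟨ha, hb⟩ := Submodule.mem_prod.1 hab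
      rw [mem_restrictTotalDegree] at ha hb
      refine ⟨⟨a, b, rfl⟩, ?_⟩
      rw [hΨ]
      refine (totalDegree_add _ _).trans (max_le ?_ ?_)
      · exact (totalDegree_mul _ _).trans (add_le_add ha H.d1)
      · exact (totalDegree_mul _ _).trans (add_le_add hb H.d2)
    · rintro ⟨⟨a, b, rfl⟩, hd⟩
      obtain ⟨c, hc1, hc2⟩ := H.reduce (k + m) (max a.totalDegree b.totalDegree) a b
        (by have := le_max_left a.totalDegree b.totalDegree; omega)
        (by have := le_max_right a.totalDegree b.totalDegree; omega) hd
      refine ⟨(a - c * g₂, b + c * g₁), Submodule.mem_prod.2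
        ⟨(mem_restrictTotalDegree _ _ _).2 hc1, (mem_restrictTotalDegree _ _ _).2 hc2⟩, ?_⟩
      rw [hΨ]; ring
  have e2 : LinearMap.ker Ψ ⊓ P = (restrictTotalDegree (Fin 2) ℂ k).map Θ := by
    ext ⟨a, b⟩
    simp only [Submodule.mem_map, Submodule.mem_inf, LinearMap.mem_ker, hΨ, hΘ, P,
      Submodule.mem_prod, mem_restrictTotalDegree, Prod.mk.injEq]
    constructor
    · rintro ⟨h0, ha, hb⟩
      obtain ⟨c, rfl, rfl⟩ := H.koszul h0
      refine ⟨c, ?_, rfl, rfl⟩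
      by_cases hc : c = 0
      · simp [hc]
      · rw [totalDegree_mul_of_isDomain hc H.symm.g1_ne, H.symm.g1_deg] at ha
        omega
    · rintro ⟨c, hc, rfl, rfl⟩
      refine ⟨by ring, ?_, ?_⟩
      · exact (totalDegree_mul _ _).trans (add_le_add hc H.d2)
      · rw [totalDegree_neg]; exact (totalDegree_mul _ _).trans (add_le_add hc H.d1)
  have h := rank_null Ψ P
  rw [e1, e2, hP, (Submodule.equivMapOfInjective Θ hΘi (restrictTotalDegree (Fin 2) ℂ k)).symm.finrank_eq] at h
  exact h

lemma finrank_Bk (H : TopData m g₁ g₂ t₁ t₂) (k : ℕ) :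
    Module.finrank ℂ ((restrictTotalDegree (Fin 2) ℂ (k + m + m)).map
      (Ideal.Quotient.mkₐ ℂ (Ideal.span {g₁, g₂})).toLinearMap) = m ^ 2 := by
  have h1 := rank_null (Ideal.Quotient.mkₐ ℂ (Ideal.span {g₁, g₂})).toLinearMap (restrictTotalDegree (Fin 2) ℂ (k + m + m))
  have h2 := H.finrank_J k
  have h3 := finrank_D k
  have h4 := finrank_D (k + m)
  have h5 := finrank_D (k + m + m)
  nlinarith

lemma finrank_B (H : TopData m g₁ g₂ t₁ t₂) : Module.finrank ℂ (T2 ⧸ Ideal.span {g₁, g₂}) = m ^ 2 := by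
  have htop : (restrictTotalDegree (Fin 2) ℂ (0 + m + m)).map (Ideal.Quotient.mkₐ ℂ (Ideal.span {g₁, g₂})).toLinearMap = ⊤ := by
    rw [eq_top_iff]
    rintro b -
    obtain ⟨p, rfl⟩ := Ideal.Quotient.mk_surjective b
    have hle : (restrictTotalDegree (Fin 2) ℂ (0 + m + m)).map (Ideal.Quotient.mkₐ ℂ (Ideal.span {g₁, g₂})).toLinearMap ≤
      (restrictTotalDegree (Fin 2) ℂ (p.totalDegree + m + m)).map (Ideal.Quotient.mkₐ ℂ (Ideal.span {g₁, g₂})).toLinearMap := by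
      apply Submodule.map_mono
      intro f hf
      rw [mem_restrictTotalDegree] at hf ⊢
      omega
    rw [Submodule.eq_of_le_of_finrank_eq hle (by rw [H.finrank_Bk, H.finrank_Bk])]
    exact ⟨p, (mem_restrictTotalDegree _ _ _).2 (by omega), rfl⟩
  rw [← finrank_top, ← htop, H.finrank_Bk]

end TopData

lemma relprime_of_zeros (t₁ t₂ : T2)
    (h : ∀ x : Fin 2 → ℂ, eval x t₁ = 0 → eval x t₂ = 0 → x = 0) : IsRelPrime t₁ t₂ := by
  apply WfDvdMonoid.isRelPrime_of_no_irreducible_factors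
  · rintro ⟨rfl, rfl⟩
    have := h (fun _ => 1) (by simp) (by simp)
    have := congrFun this 0
    simp at this
  · intro z hz h1 h2
    have hp : Prime z := hz.prime
    have hX : ∀ i : Fin 2, z ∣ X i := by
      intro i
      have : (X i : T2) ∈ (Ideal.span {z}).radical := by
        rw [← vanishingIdeal_zeroLocus_eq_radical (K := ℂ), mem_vanishingIdeal_iff]
        intro x hx
        have hzx : eval x z = 0 := by
          have := hx z (Ideal.subset_span rfl)
          simpa [aeval_eq_eval] using this
        obtain ⟨u, rfl⟩ := h1
        obtain ⟨w, rfl⟩ := h2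
        have := h x (by simp [hzx]) (by simp [hzx])
        simp [this]
      obtain ⟨n, hn⟩ := this
      rw [Ideal.mem_span_singleton] at hn
      exact hp.dvd_of_dvd_pow hn
    obtain ⟨u, hu⟩ := hX 0
    obtain ⟨w, hw⟩ := hX 1
    have hX0 : Irreducible (X 0 : T2) := X_prime.irreducible
    have hu' : IsUnit u := (hX0.isUnit_or_isUnit hu).resolve_left hz.not_isUnit
    have hd : (X 0 : T2) ∣ X 1 := by
      obtain ⟨u', rfl⟩ := hu'
      exact ⟨↑u'⁻¹ * w, by rw [hu, hw]; simp [mul_assoc]⟩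
    obtain ⟨c, hc⟩ := hd
    have := congrArg (eval ![0, 1]) hc
    simp at this

def chart (α β : ℂ) : MvPolynomial (Fin 3) ℂ →ₐ[ℂ] T2 :=
  aeval ![X 0, X 1, 1 - C α * X 0 - C β * X 1]

def chartTop (α β : ℂ) : MvPolynomial (Fin 3) ℂ →ₐ[ℂ] T2 :=
  aeval ![X 0, X 1, - C α * X 0 - C β * X 1]

def chartPt (α β : ℂ) (x : Fin 2 → ℂ) : Fin 3 → ℂ := ![x 0, x 1, 1 - α * x 0 - β * x 1]

lemma eval_chart (α β : ℂ) (x : Fin 2 → ℂ) (G : MvPolynomial (Fin 3) ℂ) :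
    eval x (chart α β G) = eval (chartPt α β x) G := by
  induction G using MvPolynomial.induction_on with
  | C a => simp [chart]
  | add p q hp hq => simp [hp, hq]
  | mul_X p i hp =>
    rw [map_mul, map_mul, hp, map_mul]
    congr 1
    fin_cases i <;> simp [chart, chartPt]

lemma eval_chartTop (α β : ℂ) (x : Fin 2 → ℂ) (G : MvPolynomial (Fin 3) ℂ) :
    eval x (chartTop α β G) = eval ![x 0, x 1, - α * x 0 - β * x 1] G := by
  induction G using MvPolynomial.induction_on with
  | C a => simp [chartTop]
  | add p q hp hq => simp [hp, hq]
  | mul_X p i hp =>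
    rw [map_mul, map_mul, hp, map_mul]
    congr 1
    fin_cases i <;> simp [chartTop]

lemma pderiv0_chart (α β : ℂ) (G : MvPolynomial (Fin 3) ℂ) :
    pderiv 0 (chart α β G) = chart α β (pderiv 0 G) - C α * chart α β (pderiv 2 G) := by
  induction G using MvPolynomial.induction_on with
  | C a => simp [chart]
  | add p q hp hq => simp only [map_add, hp, hq]; ring
  | mul_X p i hp =>
    rw [map_mul, Derivation.leibniz, hp]
    fin_cases i <;> simp [chart, Derivation.leibniz] <;> ring

lemma pderiv1_chart (α β : ℂ) (G : MvPolynomial (Fin 3) ℂ) :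
    pderiv 1 (chart α β G) = chart α β (pderiv 1 G) - C β * chart α β (pderiv 2 G) := by
  induction G using MvPolynomial.induction_on with
  | C a => simp [chart]
  | add p q hp hq => simp only [map_add, hp, hq]; ring
  | mul_X p i hp =>
    rw [map_mul, Derivation.leibniz, hp]
    fin_cases i <;> simp [chart, Derivation.leibniz] <;> ring

/-- `b` is the degree `n` part of `a`, of degree at most `n`. -/
def TopOf (n : ℕ) (a b : T2) : Prop := a.totalDegree ≤ n ∧ homogeneousComponent n a = b

lemma TopOf.mul {n k : ℕ} {a b a' b' : T2} (h : TopOf n a b) (h' : TopOf k a' b') :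
    TopOf (n + k) (a * a') (b * b') :=
  ⟨(totalDegree_mul _ _).trans (add_le_add h.1 h'.1), by
    rw [hc_mul _ _ _ _ h.1 h'.1, h.2, h'.2]⟩

lemma TopOf.of_hom {n : ℕ} {a : T2} (h : a.IsHomogeneous n) : TopOf n a a :=
  ⟨h.totalDegree_le, homogeneousComponent_eq_self h⟩

lemma TopOf.add {n : ℕ} {a b a' b' : T2} (h : TopOf n a b) (h' : TopOf n a' b') :
    TopOf n (a + a') (b + b') :=
  ⟨(totalDegree_add _ _).trans (max_le h.1 h'.1), by rw [map_add, h.2, h'.2]⟩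

lemma TopOf.sum {n : ℕ} {ι : Type*} (s : Finset ι) (a b : ι → T2) (h : ∀ i ∈ s, TopOf n (a i) (b i)) :
    TopOf n (∑ i ∈ s, a i) (∑ i ∈ s, b i) := by
  classical
  induction s using Finset.induction_on with
  | empty => exact ⟨by simp, by simp⟩
  | insert i s hi ih =>
    rw [Finset.sum_insert hi, Finset.sum_insert hi]
    exact (h i (by simp)).add (ih fun j hj => h j (by simp [hj]))

lemma TopOf.pow {n : ℕ} {a b : T2} (h : TopOf n a b) (k : ℕ) : TopOf (k * n) (a ^ k) (b ^ k) := by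
  induction k with
  | zero => simpa using TopOf.of_hom (isHomogeneous_one (Fin 2) ℂ)
  | succ k ih => rw [pow_succ, pow_succ, Nat.succ_mul]; exact ih.mul h

lemma topOf_chart (α β : ℂ) {m : ℕ} {G : MvPolynomial (Fin 3) ℂ} (hG : G.IsHomogeneous m) :
    TopOf m (chart α β G) (chartTop α β G) := by
  rw [chart, chartTop, aeval_def, aeval_def, eval₂_eq', eval₂_eq']
  apply TopOf.sum
  intro s hs
  have hs' : s 0 + s 1 + s 2 = m := by
    have := hG.degree_eq_sum_deg_support hs
    have h3 := Finsupp.degree_eq_sum s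
    rw [Fin.sum_univ_three] at h3
    rw [this, ← h3]; rfl
  have h0 : TopOf 1 (X 0 : T2) (X 0) := .of_hom (isHomogeneous_X _ _)
  have h1 : TopOf 1 (X 1 : T2) (X 1) := .of_hom (isHomogeneous_X _ _)
  have h2 : TopOf 1 (1 - C α * X 0 - C β * X 1 : T2) (- C α * X 0 - C β * X 1) := by
    have ha : TopOf 1 (1 : T2) 0 := ⟨by simp, homogeneousComponent_eq_zero _ _ (by simp)⟩
    have hb : (- C α * X 0 - C β * X 1 : T2).IsHomogeneous 1 := by
      rw [← map_neg]
      exact (isHomogeneous_C_mul_X _ _).sub (isHomogeneous_C_mul_X _ _)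
    have := ha.add (TopOf.of_hom hb)
    rw [zero_add] at this
    convert this using 1
    ring
  have hc : TopOf 0 (C (coeff s G) : T2) (C (coeff s G)) := .of_hom (isHomogeneous_C _ _)
  have := hc.mul (((h0.pow (s 0)).mul (h1.pow (s 1))).mul (h2.pow (s 2)))
  simp only [Fin.prod_univ_three]
  have e : 0 + (s 0 * 1 + s 1 * 1 + s 2 * 1) = m := by omega
  rw [e] at this
  exact this

lemma eval_smul_hom {m : ℕ} {G : MvPolynomial (Fin 3) ℂ} (hG : G.IsHomogeneous m) (c : ℂ)
    (v : Fin 3 → ℂ) : eval (c • v) G = c ^ m * eval v G := by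
  rw [eval_eq', eval_eq', Finset.mul_sum]
  refine Finset.sum_congr rfl fun s hs => ?_
  have hs' : s 0 + s 1 + s 2 = m := by
    have := hG.degree_eq_sum_deg_support hs
    have h3 := Finsupp.degree_eq_sum s
    rw [Fin.sum_univ_three] at h3
    rw [this, ← h3]; rfl
  simp only [Fin.prod_univ_three, Pi.smul_apply, smul_eq_mul, mul_pow, ← hs', pow_add]
  ring

lemma vanAt_mk {m : ℕ} {G : MvPolynomial (Fin 3) ℂ} (hG : G.IsHomogeneous m) 
    (v : Fin 3 → ℂ) (hv : v ≠ 0) : VanAt G (Projectivization.mk ℂ v hv) ↔ eval v G = 0 := by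
  obtain ⟨a, ha⟩ := Projectivization.exists_smul_eq_mk_rep ℂ v hv
  rw [VanAt, ← ha]
  have : (a • v) = (a : ℂ) • v := rfl
  rw [this, eval_smul_hom hG]
  simp

lemma euler {m : ℕ} {G : MvPolynomial (Fin 3) ℂ} (hG : G.IsHomogeneous m) (v : Fin 3 → ℂ) :
    v 0 * eval v (pderiv 0 G) + v 1 * eval v (pderiv 1 G) + v 2 * eval v (pderiv 2 G) =
      m * eval v G := by
  have := congrArg (eval v) hG.sum_X_mul_pderiv
  simpa [Fin.sum_univ_three] using this

/-- `G₁` and `G₂` meet transversally at every common zero. -/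
def Transv (G₁ G₂ : MvPolynomial (Fin 3) ℂ) : Prop :=
  ∀ v : Fin 3 → ℂ, v ≠ 0 → eval v G₁ = 0 → eval v G₂ = 0 → ∀ a b : ℂ,
    (∀ l, a * eval v (pderiv l G₁) + b * eval v (pderiv l G₂) = 0) → a = 0 ∧ b = 0

lemma chartPt_form (α β : ℂ) (x : Fin 2 → ℂ) :
    α * chartPt α β x 0 + β * chartPt α β x 1 + chartPt α β x 2 = 1 := by
  simp [chartPt]

lemma chartPt_ne (α β : ℂ) (x : Fin 2 → ℂ) : chartPt α β x ≠ 0 := by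
  intro h
  have := chartPt_form α β x
  simp [h] at this

lemma jac_alg (A0 A1 A2 B0 B1 B2 v0 v1 v2 α β : ℂ) (hf : α * v0 + β * v1 + v2 = 1)
    (e1 : v0 * A0 + v1 * A1 + v2 * A2 = 0) (e2 : v0 * B0 + v1 * B1 + v2 * B2 = 0)
    (hJ : (A0 - α * A2) * (B1 - β * B2) - (A1 - β * A2) * (B0 - α * B2) = 0) :
    ∃ a b : ℂ, ¬ (a = 0 ∧ b = 0) ∧ a * A0 + b * B0 = 0 ∧ a * A1 + b * B1 = 0 ∧
      a * A2 + b * B2 = 0 := by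
  have hdet : Matrix.det !![A0 - α * A2, A1 - β * A2; B0 - α * B2, B1 - β * B2] = 0 := by
    rw [Matrix.det_fin_two_of]; exact hJ
  obtain ⟨w, hw0, hw⟩ := Matrix.exists_vecMul_eq_zero_iff.2 hdet
  have w0 := congrFun hw 0
  have w1 := congrFun hw 1
  simp [Matrix.vecMul, dotProduct, Fin.sum_univ_two] at w0 w1
  have hu2 : w 0 * A2 + w 1 * B2 = 0 := by
    linear_combination (-(w 0 * A2 + w 1 * B2)) * hf + w 0 * e1 + w 1 * e2 - v0 * w0 - v1 * w1
  refine ⟨w 0, w 1, ?_, ?_, ?_, hu2⟩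
  · rintro ⟨ha, hb⟩
    apply hw0
    ext i; fin_cases i <;> assumption
  · linear_combination w0 + α * hu2
  · linear_combination w1 + β * hu2

lemma jac_chart {m : ℕ} {G₁ G₂ : MvPolynomial (Fin 3) ℂ} (h₁ : G₁.IsHomogeneous m)
    (h₂ : G₂.IsHomogeneous m) (ht : Transv G₁ G₂) (α β : ℂ) :
    ∀ x ∈ affZ (chart α β G₁) (chart α β G₂),
      eval x (jac2 (chart α β G₁) (chart α β G₂)) ≠ 0 := by
  rintro x ⟨hx1, hx2⟩ hJ
  rw [eval_chart] at hx1 hx2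
  have e1 := euler h₁ (chartPt α β x)
  have e2 := euler h₂ (chartPt α β x)
  have hT := ht (chartPt α β x) (chartPt_ne α β x) hx1 hx2
  rw [hx1, mul_zero] at e1
  rw [hx2, mul_zero] at e2
  simp only [jac2, pderiv0_chart, pderiv1_chart, map_sub, map_mul, eval_chart, eval_C] at hJ
  obtain ⟨a, b, hab, h0, h1, h2⟩ := jac_alg _ _ _ _ _ _ _ _ _ _ _ (chartPt_form α β x) e1 e2 hJ
  apply hab
  apply hT a b
  intro l
  match l with
  | 0 => exact h0
  | 1 => exact h1
  | 2 => exact h2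

def chartP (α β : ℂ) (x : Fin 2 → ℂ) : P2 :=
  Projectivization.mk ℂ (chartPt α β x) (chartPt_ne α β x)

lemma chartP_inj (α β : ℂ) : Function.Injective (chartP α β) := by
  intro x y h
  obtain ⟨a, ha⟩ := (Projectivization.mk_eq_mk_iff' _ _ _ _ _).1 h
  have fx := chartPt_form α β x
  have fy := chartPt_form α β y
  rw [← ha] at fx
  simp only [Pi.smul_apply, smul_eq_mul] at fx
  have ha1 : a = 1 := by linear_combination fx - a * fy
  rw [ha1, one_smul] at ha
  ext i
  fin_cases i
  · simpa [chartPt] using (congrFun ha 0).symm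
  · simpa [chartPt] using (congrFun ha 1).symm

lemma chart_image {m : ℕ} {G₁ G₂ : MvPolynomial (Fin 3) ℂ} (h₁ : G₁.IsHomogeneous m)
    (h₂ : G₂.IsHomogeneous m) (α β : ℂ) :
    chartP α β '' affZ (chart α β G₁) (chart α β G₂) =
      {p ∈ zeroSet G₁ G₂ | α * p.rep 0 + β * p.rep 1 + p.rep 2 ≠ 0} := by
  ext p
  constructor
  · rintro ⟨x, ⟨hx1, hx2⟩, rfl⟩
    rw [eval_chart] at hx1 hx2
    refine ⟨⟨(vanAt_mk h₁ _ _).2 hx1, (vanAt_mk h₂ _ _).2 hx2⟩, ?_⟩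
    obtain ⟨a, ha⟩ := Projectivization.exists_smul_eq_mk_rep ℂ _ (chartPt_ne α β x)
    have : (chartP α β x).rep = (a : ℂ) • chartPt α β x := ha.symm
    rw [this]
    simp only [Pi.smul_apply, smul_eq_mul]
    have fx := chartPt_form α β x
    have : α * (a * chartPt α β x 0) + β * (a * chartPt α β x 1) + a * chartPt α β x 2 = (a : ℂ) := by
      linear_combination (a : ℂ) * fx
    rw [this]
    exact a.ne_zero
  · rintro ⟨⟨h1, h2⟩, hne⟩
    set c := α * p.rep 0 + β * p.rep 1 + p.rep 2 with hc
    have hv : chartPt α β ![c⁻¹ * p.rep 0, c⁻¹ * p.rep 1] = c⁻¹ • p.rep := by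
      ext i
      fin_cases i
      · simp [chartPt]
      · simp [chartPt]
      · simp [chartPt]
        field_simp
        rw [hc]; ring
    refine ⟨![c⁻¹ * p.rep 0, c⁻¹ * p.rep 1], ⟨?_, ?_⟩, ?_⟩
    · rw [eval_chart, hv, eval_smul_hom h₁, show eval p.rep G₁ = 0 from h1, mul_zero]
    · rw [eval_chart, hv, eval_smul_hom h₂, show eval p.rep G₂ = 0 from h2, mul_zero]
    · conv_rhs => rw [← p.mk_rep]
      rw [chartP, Projectivization.mk_eq_mk_iff']
      exact ⟨c⁻¹, hv.symm⟩

lemma zeroSet_finite {m : ℕ} {G₁ G₂ : MvPolynomial (Fin 3) ℂ} (h₁ : G₁.IsHomogeneous m)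
    (h₂ : G₂.IsHomogeneous m) (ht : Transv G₁ G₂) : (zeroSet G₁ G₂).Finite := by
  have hch : ∀ α β : ℂ, {p ∈ zeroSet G₁ G₂ | α * p.rep 0 + β * p.rep 1 + p.rep 2 ≠ 0}.Finite := by
    intro α β
    rw [← chart_image h₁ h₂]
    exact (aff_count _ _ (jac_chart h₁ h₂ ht α β)).1.image _
  refine (((hch 0 0).union (hch 1 0)).union (hch 0 1)).subset ?_
  intro p hp
  by_contra hcon
  simp only [Set.mem_union, Set.mem_ofPred_eq, hp, true_and, not_or, not_not, zero_mul, one_mul,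
    zero_add, add_zero] at hcon
  obtain ⟨⟨a, b⟩, c⟩ := hcon
  apply p.rep_nonzero
  rw [a, add_zero] at b c
  ext i; fin_cases i <;> assumption

lemma exists_avoid (S : Set P2) (hS : S.Finite) :
    ∃ α β : ℂ, ∀ p ∈ S, α * p.rep 0 + β * p.rep 1 + p.rep 2 ≠ 0 := by
  classical
  let f : P2 → T2 := fun p => C (p.rep 0) * X 0 + C (p.rep 1) * X 1 + C (p.rep 2)
  have hf : ∀ p, f p ≠ 0 := by
    intro p h0
    have e0 := congrArg (eval ![0, 0]) h0
    have e1 := congrArg (eval ![1, 0]) h0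
    have e2 := congrArg (eval ![0, 1]) h0
    simp [f] at e0 e1 e2
    rw [e0, add_zero] at e1 e2
    apply p.rep_nonzero
    ext i; fin_cases i <;> assumption
  have hprod : ∏ p ∈ hS.toFinset, f p ≠ 0 := Finset.prod_ne_zero_iff.2 fun p _ => hf p
  obtain ⟨x, hx⟩ : ∃ x : Fin 2 → ℂ, eval x (∏ p ∈ hS.toFinset, f p) ≠ 0 := by
    by_contra hcon
    push Not at hcon
    exact hprod (MvPolynomial.funext fun x => by rw [hcon x, map_zero])
  refine ⟨x 0, x 1, fun p hp => ?_⟩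
  rw [map_prod, Finset.prod_ne_zero_iff] at hx
  have := hx p (hS.mem_toFinset.2 hp)
  simp [f] at this
  convert this using 1
  ring

theorem bezout {m : ℕ} (hm : 1 ≤ m) {G₁ G₂ : MvPolynomial (Fin 3) ℂ} (h₁ : G₁.IsHomogeneous m)
    (h₂ : G₂.IsHomogeneous m) (ht : Transv G₁ G₂) :
    (zeroSet G₁ G₂).Finite ∧ (zeroSet G₁ G₂).ncard = m ^ 2 := by
  have hfin := zeroSet_finite h₁ h₂ ht
  refine ⟨hfin, ?_⟩
  obtain ⟨α, β, hαβ⟩ := exists_avoid _ hfin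
  have himg := chart_image h₁ h₂ α β
  have : {p ∈ zeroSet G₁ G₂ | α * p.rep 0 + β * p.rep 1 + p.rep 2 ≠ 0} = zeroSet G₁ G₂ := by
    ext p; exact ⟨fun h => h.1, fun h => ⟨h, hαβ p h⟩⟩
  rw [this] at himg
  rw [← himg, Set.ncard_image_of_injective _ (chartP_inj α β),
    (aff_count _ _ (jac_chart h₁ h₂ ht α β)).2]
  have H1 := topOf_chart α β h₁
  have H2 := topOf_chart α β h₂
  refine TopData.finrank_B ⟨hm, H1.1, H2.1, H1.2, H2.2, ?_⟩
  apply relprime_of_zeros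
  intro x hx1 hx2
  rw [eval_chartTop] at hx1 hx2
  by_contra hx0
  have hv : (![x 0, x 1, -α * x 0 - β * x 1] : Fin 3 → ℂ) ≠ 0 := by
    intro h
    apply hx0
    have a := congrFun h 0
    have b := congrFun h 1
    simp at a b
    ext i; fin_cases i <;> assumption
  have hmem : Projectivization.mk ℂ _ hv ∈ zeroSet G₁ G₂ :=
    ⟨(vanAt_mk h₁ _ _).2 hx1, (vanAt_mk h₂ _ _).2 hx2⟩
  obtain ⟨a, ha⟩ := Projectivization.exists_smul_eq_mk_rep ℂ _ hv
  apply hαβ _ hmem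
  have : (Projectivization.mk ℂ _ hv).rep = (a : ℂ) • (![x 0, x 1, -α * x 0 - β * x 1] : Fin 3 → ℂ) :=
    ha.symm
  rw [this]
  simp
  ring

/-- The gradient map of `F`. -/
def grad (F : MvPolynomial (Fin 3) ℂ) (v : Fin 3 → ℂ) : Fin 3 → ℂ :=
  fun i => eval v (pderiv i F)

/-- The Hessian matrix of `F`. -/
def hess (F : MvPolynomial (Fin 3) ℂ) (v : Fin 3 → ℂ) : Matrix (Fin 3) (Fin 3) ℂ :=
  Matrix.of fun i j : Fin 3 => eval v (pderiv i (pderiv j F))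

lemma pd_comm (F : MvPolynomial (Fin 3) ℂ) (i j : Fin 3) :
    pderiv i (pderiv j F) = pderiv j (pderiv i F) := by
  induction F using MvPolynomial.induction_on with
  | C a => simp
  | add p q hp hq => simp [hp, hq]
  | mul_X p k hp =>
    have hX : ∀ a b c : Fin 3, pderiv a (Pi.single (M := fun _ => MvPolynomial (Fin 3) ℂ) b 1 c) = 0 := by
      intro a b c
      rcases eq_or_ne c b with h | h
      · subst h; simp
      · simp [Pi.single_eq_of_ne h]
    simp only [Derivation.leibniz, pderiv_X, map_add, smul_eq_mul, hp, hX]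
    ring

lemma hess_symm (F : MvPolynomial (Fin 3) ℂ) (v : Fin 3 → ℂ) : (hess F v).transpose = hess F v := by
  ext i j
  simp only [hess, Matrix.transpose_apply, Matrix.of_apply]
  rw [pd_comm]

lemma hasFDerivAt_eval (G : MvPolynomial (Fin 3) ℂ) (v : Fin 3 → ℂ) :
    HasFDerivAt (fun v : Fin 3 → ℂ => eval v G)
      (∑ j, eval v (pderiv j G) • (ContinuousLinearMap.proj j : (Fin 3 → ℂ) →L[ℂ] ℂ)) v := by
  induction G using MvPolynomial.induction_on with
  | C a =>
    have h := hasFDerivAt_const (𝕜 := ℂ) a v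
    simp only [eval_C]
    refine h.congr_fderiv ?_
    ext w
    simp
  | add p q hp hq =>
    have := hp.add hq
    refine (this.congr_fderiv ?_).congr_of_eventuallyEq (Filter.Eventually.of_forall ?_)
    · ext w
      simp only [map_add, Fin.sum_univ_three, ContinuousLinearMap.add_apply,
        ContinuousLinearMap.smul_apply, smul_eq_mul]
      ring
    · intro x
      simp
  | mul_X p k hp =>
    have hk : HasFDerivAt (fun v : Fin 3 → ℂ => v k)
      (ContinuousLinearMap.proj k : (Fin 3 → ℂ) →L[ℂ] ℂ) v := hasFDerivAt_apply k v
    have := hp.mul hk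
    simp only [map_mul, eval_X]
    refine this.congr_fderiv ?_
    ext w
    simp [Derivation.leibniz, pderiv_X, Fin.sum_univ_three, Pi.single_apply]
    fin_cases k <;> simp <;> ring

lemma hasFDerivAt_grad (F : MvPolynomial (Fin 3) ℂ) (v : Fin 3 → ℂ) :
    HasFDerivAt (grad F) (LinearMap.toContinuousLinearMap (Matrix.toLin' (hess F v))) v := by
  rw [hasFDerivAt_pi']
  intro i
  refine (hasFDerivAt_eval (pderiv i F) v).congr_fderiv ?_
  ext w
  simp [hess, Matrix.mulVec, dotProduct, Fin.sum_univ_three, pd_comm F i]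

open MeasureTheory in
lemma sard (F : MvPolynomial (Fin 3) ℂ) :
    (volume : Measure (Fin 3 → ℂ)) (grad F '' {v | (hess F v).det = 0}) = 0 := by
  refine addHaar_image_eq_zero_of_det_fderivWithin_eq_zero volume
    (f' := fun v => (LinearMap.toContinuousLinearMap (Matrix.toLin' (hess F v))).restrictScalars ℝ)
    (fun v _ => ((hasFDerivAt_grad F v).restrictScalars ℝ).hasFDerivWithinAt) ?_
  intro v hv
  have h := LinearMap.det_restrictScalars (R := ℝ) (f := Matrix.toLin' (hess F v))
  rw [LinearMap.det_toLin', show (hess F v).det = 0 from hv, Algebra.norm_zero] at h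
  exact h

open MeasureTheory in
lemma sub_null (W : Submodule ℂ (Fin 3 → ℂ)) (hW : W ≠ ⊤) :
    (volume : Measure (Fin 3 → ℂ)) (W : Set (Fin 3 → ℂ)) = 0 := by
  refine Measure.addHaar_submodule volume (W.restrictScalars ℝ) ?_
  rwa [Ne, Submodule.restrictScalars_eq_top_iff]

lemma hyper_ne_top {p : Fin 3 → ℂ} (hp : p ≠ 0) :
    LinearMap.ker (dotProductBilin ℂ ℂ p) ≠ ⊤ := by
  intro h
  apply hp
  rw [LinearMap.ker_eq_top] at h
  ext i
  have := congrArg (fun f => f (Pi.single i 1)) h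
  simpa using this

/-- The set of bad directions. -/
def badSet (F : MvPolynomial (Fin 3) ℂ) : Set (Fin 3 → ℂ) :=
  (grad F '' {v | (hess F v).det = 0}) ∪ ⋃ p ∈ nodes F, {q | p.rep ⬝ᵥ q = 0}

open MeasureTheory in
lemma bad_null (F : MvPolynomial (Fin 3) ℂ) (hfin : (nodes F).Finite) :
    (volume : Measure (Fin 3 → ℂ)) (badSet F) = 0 := by
  refine measure_union_null (sard F) ((measure_biUnion_null_iff hfin.countable).2 ?_)
  intro p _
  exact sub_null _ (hyper_ne_top p.rep_nonzero)

open MeasureTheory in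
lemma exists_good (F : MvPolynomial (Fin 3) ℂ) (hfin : (nodes F).Finite)
    (W : Submodule ℂ (Fin 3 → ℂ)) (hW : W ≠ ⊤) : ∃ q, q ∉ badSet F ∧ q ∉ W := by
  by_contra hcon
  push Not at hcon
  have h0 := measure_union_null (bad_null F hfin) (sub_null W hW)
  have : badSet F ∪ (W : Set (Fin 3 → ℂ)) = Set.univ := by
    ext q
    simp only [Set.mem_union, Set.mem_univ, iff_true]
    by_cases hq : q ∈ badSet F
    · exact Or.inl hq
    · exact Or.inr (hcon q hq)
  rw [this] at h0
  exact NeZero.ne _ (Measure.measure_univ_eq_zero.1 h0)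

lemma span_ne_top {n : ℕ} (hn : n < 3) (q : Fin n → Fin 3 → ℂ) :
    Submodule.span ℂ (Set.range q) ≠ ⊤ := by
  intro h
  have h1 := finrank_range_le_card (R := ℂ) q
  rw [Set.finrank, h, finrank_top] at h1
  simp at h1
  omega

lemma exists_Q (F : MvPolynomial (Fin 3) ℂ) (hfin : (nodes F).Finite) :
    ∃ q : Fin 3 → Fin 3 → ℂ, LinearIndependent ℂ q ∧ ∀ k, q k ∉ badSet F := by
  have : ∀ n ≤ 3, ∃ q : Fin n → Fin 3 → ℂ, LinearIndependent ℂ q ∧ ∀ k, q k ∉ badSet F := by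
    intro n
    induction n with
    | zero => intro _; exact ⟨Fin.elim0, linearIndependent_empty_type, fun k => k.elim0⟩
    | succ n ih =>
      intro hn
      obtain ⟨q, hq, hb⟩ := ih (by omega)
      obtain ⟨x, hx, hxW⟩ := exists_good F hfin _ (span_ne_top (by omega) q)
      refine ⟨Fin.cons x q, linearIndependent_finCons.2 ⟨hq, hxW⟩, ?_⟩
      intro k
      refine Fin.cases ?_ ?_ k
      · simpa using hx
      · intro i; simpa using hb i
  exact this 3 le_rfl

lemma grad_smul {d : ℕ} {F : MvPolynomial (Fin 3) ℂ} (hF : F.IsHomogeneous d) (c : ℂ)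
    (v : Fin 3 → ℂ) : grad F (c • v) = c ^ (d - 1) • grad F v := by
  ext i
  exact eval_smul_hom hF.pderiv c v

lemma hess_smul {d : ℕ} {F : MvPolynomial (Fin 3) ℂ} (hF : F.IsHomogeneous d) (c : ℂ)
    (v : Fin 3 → ℂ) : hess F (c • v) = c ^ (d - 1 - 1) • hess F v := by
  ext i j
  exact eval_smul_hom hF.pderiv.pderiv c v

lemma hess_mulVec_self {d : ℕ} {F : MvPolynomial (Fin 3) ℂ} (hF : F.IsHomogeneous d)
    (v : Fin 3 → ℂ) : (hess F v).mulVec v = ((d - 1 : ℕ) : ℂ) • grad F v := by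
  ext i
  have h := euler (hF.pderiv (i := i)) v
  simp only [Pi.smul_apply, smul_eq_mul, grad]
  rw [← h]
  simp only [hess, Matrix.mulVec, dotProduct, Matrix.of_apply, Fin.sum_univ_three]
  rw [pd_comm F i 0, pd_comm F i 1, pd_comm F i 2]
  ring

lemma key {d : ℕ} (hd : 3 ≤ d) {F : MvPolynomial (Fin 3) ℂ} (hF : F.IsHomogeneous d)
    (hnodal : Nodal F) {q : Fin 3 → ℂ} (hq : q ∉ badSet F) {v : Fin 3 → ℂ} (hv : v ≠ 0) {c : ℂ}
    (hc : grad F v = c • q) {w : Fin 3 → ℂ} (hw : (hess F v).mulVec w = 0) (hwq : w ⬝ᵥ q = 0) :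
    w = 0 := by
  by_cases hc0 : c = 0
  · rw [hc0, zero_smul] at hc
    obtain ⟨a, ha⟩ := Projectivization.exists_smul_eq_mk_rep ℂ v hv
    have hrep : (Projectivization.mk ℂ v hv).rep = (a : ℂ) • v := ha.symm
    have hs : SingPt F (Projectivization.mk ℂ v hv) := by
      intro i
      have : grad F (Projectivization.mk ℂ v hv).rep = 0 := by
        rw [hrep, grad_smul hF, hc, smul_zero]
      exact congrFun this i
    have hnode := hnodal _ hs
    have hrk : (hess F (Projectivization.mk ℂ v hv).rep).rank = 2 := hnode.2
    have hnz := (Projectivization.mk ℂ v hv).rep_nonzero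
    have hbq : (Projectivization.mk ℂ v hv).rep ⬝ᵥ q ≠ 0 := by
      intro h
      apply hq
      right
      exact Set.mem_biUnion (show Projectivization.mk ℂ v hv ∈ nodes F from hnode) h
    have hg : grad F (Projectivization.mk ℂ v hv).rep = 0 := funext hs
    have hw' : (hess F (Projectivization.mk ℂ v hv).rep).mulVec w = 0 := by
      rw [hrep, hess_smul hF, Matrix.smul_mulVec, hw, smul_zero]
    generalize (Projectivization.mk ℂ v hv).rep = r at *
    have hr : (hess F r).mulVec r = 0 := by rw [hess_mulVec_self hF, hg, smul_zero]
    have hrn := LinearMap.finrank_range_add_finrank_ker (hess F r).mulVecLin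
    rw [← Matrix.rank, hrk] at hrn
    have hk1 : Module.finrank ℂ (LinearMap.ker (hess F r).mulVecLin) = 1 := by
      simp at hrn
      omega
    have hrk' : r ∈ LinearMap.ker (hess F r).mulVecLin := hr
    have hwk' : w ∈ LinearMap.ker (hess F r).mulVecLin := hw'
    obtain ⟨s, hs⟩ := (finrank_eq_one_iff_of_nonzero' (⟨r, hrk'⟩ : LinearMap.ker (hess F r).mulVecLin)
      (by simpa [Subtype.ext_iff] using hnz)).1 hk1 ⟨w, hwk'⟩
    have hs' : s • r = w := congrArg Subtype.val hs
    rw [← hs', smul_dotProduct, smul_eq_mul] at hwq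
    rcases mul_eq_zero.1 hwq with h | h
    · rw [← hs', h, zero_smul]
    · exact absurd h hbq
  · obtain ⟨l, hl⟩ := IsAlgClosed.exists_pow_nat_eq c⁻¹ (show 0 < d - 1 by omega)
    have hg : grad F (l • v) = q := by
      rw [grad_smul hF, hl, hc, smul_smul, inv_mul_cancel₀ hc0, one_smul]
    have hdet : (hess F (l • v)).det ≠ 0 := by
      intro h
      exact hq (Or.inl ⟨l • v, h, hg⟩)
    apply Matrix.eq_zero_of_mulVec_eq_zero hdet
    rw [hess_smul hF, Matrix.smul_mulVec, hw, smul_zero]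

/-- The directional derivative of `F` along `a`. -/
def dirD (F : MvPolynomial (Fin 3) ℂ) (a : Fin 3 → ℂ) : MvPolynomial (Fin 3) ℂ :=
  ∑ l, a l • pderiv l F

lemma eval_dirD (F : MvPolynomial (Fin 3) ℂ) (a v : Fin 3 → ℂ) :
    eval v (dirD F a) = a ⬝ᵥ grad F v := by
  simp [dirD, dotProduct, grad, smul_eval]

lemma eval_pd_dirD (F : MvPolynomial (Fin 3) ℂ) (a v : Fin 3 → ℂ) (l : Fin 3) :
    eval v (pderiv l (dirD F a)) = (hess F v).mulVec a l := by
  simp [dirD, Matrix.mulVec, dotProduct, hess, smul_eval, mul_comm]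

lemma dirD_hom {d : ℕ} {F : MvPolynomial (Fin 3) ℂ} (hF : F.IsHomogeneous d) (a : Fin 3 → ℂ) :
    (dirD F a).IsHomogeneous (d - 1) := by
  rw [← mem_homogeneousSubmodule]
  exact Submodule.sum_mem _ fun l _ => Submodule.smul_mem _ _
    ((mem_homogeneousSubmodule _ _).2 hF.pderiv)

lemma dual_exists (q : Fin 3 → Fin 3 → ℂ) (hq : LinearIndependent ℂ q) :
    ∃ a : Fin 3 → Fin 3 → ℂ, (∀ i k, a i ⬝ᵥ q k = if i = k then 1 else 0) ∧
      ∀ l l', ∑ k, a k l * q k l' = if l = l' then 1 else 0 := by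
  have hu : IsUnit (Matrix.of q) := Matrix.linearIndependent_rows_iff_isUnit.1 hq
  have hd := (Matrix.isUnit_iff_isUnit_det _).1 hu
  refine ⟨fun k l => (Matrix.of q)⁻¹ l k, ?_, ?_⟩
  · intro i k
    have := congrFun (congrFun (Matrix.mul_nonsing_inv _ hd) k) i
    rw [Matrix.mul_apply, Matrix.one_apply] at this
    simp only [dotProduct]
    simp only [eq_comm (a := i)]
    rw [← this]
    exact Finset.sum_congr rfl fun l _ => mul_comm _ _
  · intro l l'
    have := congrFun (congrFun (Matrix.nonsing_inv_mul _ hd) l) l'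
    rw [Matrix.mul_apply, Matrix.one_apply] at this
    exact this

lemma expand {q a : Fin 3 → Fin 3 → ℂ}
    (h : ∀ l l', ∑ k, a k l * q k l' = if l = l' then 1 else 0) (g : Fin 3 → ℂ) :
    g = ∑ k, (a k ⬝ᵥ g) • q k := by
  ext l'
  have : ∑ l, g l * (∑ k, a k l * q k l') = g l' := by simp [h]
  rw [← this]
  simp only [Finset.sum_apply, Pi.smul_apply, smul_eq_mul, dotProduct, Finset.mul_sum,
    Finset.sum_mul]
  rw [Finset.sum_comm]
  exact Finset.sum_congr rfl fun k _ => Finset.sum_congr rfl fun l _ => by ring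

lemma pd_expand (F : MvPolynomial (Fin 3) ℂ) {q a : Fin 3 → Fin 3 → ℂ}
    (h : ∀ l l', ∑ k, a k l * q k l' = if l = l' then 1 else 0) (l' : Fin 3) :
    pderiv l' F = ∑ k, q k l' • dirD F (a k) := by
  have : ∑ l, (∑ k, a k l * q k l') • pderiv l F = pderiv l' F := by simp [h]
  rw [← this]
  simp only [dirD, Finset.smul_sum, Finset.sum_smul, smul_smul]
  rw [Finset.sum_comm]
  exact Finset.sum_congr rfl fun k _ => Finset.sum_congr rfl fun l _ => by rw [mul_comm]

lemma third (i j : Fin 3) (hij : i ≠ j) : ∃ k, k ≠ i ∧ k ≠ j ∧ ∀ l, l = i ∨ l = j ∨ l = k := by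
  revert i j
  decide

lemma grad_of_zero (F : MvPolynomial (Fin 3) ℂ) {q a : Fin 3 → Fin 3 → ℂ}
    (h : ∀ l l', ∑ k, a k l * q k l' = if l = l' then 1 else 0) {i j k : Fin 3}
    (hk : ∀ l, l = i ∨ l = j ∨ l = k) {v : Fin 3 → ℂ}
    (hi : eval v (dirD F (a i)) = 0) (hj : eval v (dirD F (a j)) = 0) :
    grad F v = eval v (dirD F (a k)) • q k := by
  rw [eval_dirD] at *
  refine (expand h (grad F v)).trans ?_
  refine Finset.sum_eq_single k ?_ (by simp)
  intro b _ hb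
  rcases hk b with rfl | rfl | rfl
  · rw [hi, zero_smul]
  · rw [hj, zero_smul]
  · exact absurd rfl hb

lemma transv_dir {d : ℕ} (hd : 3 ≤ d) {F : MvPolynomial (Fin 3) ℂ} (hF : F.IsHomogeneous d)
    (hnodal : Nodal F) {q a : Fin 3 → Fin 3 → ℂ} (hq : ∀ k, q k ∉ badSet F)
    (ha : ∀ i k, a i ⬝ᵥ q k = if i = k then 1 else 0)
    (h : ∀ l l', ∑ k, a k l * q k l' = if l = l' then 1 else 0) {i j : Fin 3} (hij : i ≠ j) :
    Transv (dirD F (a i)) (dirD F (a j)) := by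
  intro v hv hi hj s t hst
  obtain ⟨k, hki, hkj, hk⟩ := third i j hij
  have hw : s • a i + t • a j = 0 := by
    refine key hd hF hnodal (hq k) hv (grad_of_zero F h hk hi hj) ?_ ?_
    · ext l
      have := hst l
      rw [eval_pd_dirD, eval_pd_dirD] at this
      simpa [Matrix.mulVec_add, Matrix.mulVec_smul] using this
    · simp [add_dotProduct, smul_dotProduct, ha, hki.symm, hkj.symm]
  constructor
  · have := congrArg (· ⬝ᵥ q i) hw
    simpa [add_dotProduct, smul_dotProduct, ha, hij.symm] using this
  · have := congrArg (· ⬝ᵥ q j) hw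
    simpa [add_dotProduct, smul_dotProduct, ha, hij] using this

theorem stmt_5 (d : ℕ) (hd : 3 ≤ d) (F : MvPolynomial (Fin 3) ℂ)
    (hF : F.IsHomogeneous d) (hirr : Irreducible F) (hnodal : Nodal F)
    (hfin : (nodes F).Finite)
    (hn : (nodes F).ncard ≤ (d - 1).choose 2 - 1) :
    ∃ G : Fin 3 → MvPolynomial (Fin 3) ℂ,
      (∀ i, G i ∈ Submodule.span ℂ {pderiv 0 F, pderiv 1 F, pderiv 2 F}) ∧
      LinearIndependent ℂ G ∧
      Submodule.span ℂ (Set.range G) =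
        Submodule.span ℂ {pderiv 0 F, pderiv 1 F, pderiv 2 F} ∧
      ∀ i j : Fin 3, i ≠ j → ∃ S : Set P2, S.Finite ∧
        S.ncard = (d - 1) ^ 2 - (nodes F).ncard ∧ Disjoint S (nodes F) ∧
        zeroSet (G i) (G j) = nodes F ∪ S := by
  obtain ⟨q, hqi, hq⟩ := exists_Q F hfin
  obtain ⟨a, ha, hb⟩ := dual_exists q hqi
  have hmem : ∀ i, dirD F (a i) ∈ Submodule.span ℂ {pderiv 0 F, pderiv 1 F, pderiv 2 F} := by
    intro i
    refine Submodule.sum_mem _ fun l _ => Submodule.smul_mem _ _ (Submodule.subset_span ?_)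
    fin_cases l <;> simp
  have hsub : ∀ i j, nodes F ⊆ zeroSet (dirD F (a i)) (dirD F (a j)) := by
    intro i j p hp
    have hg : grad F p.rep = 0 := funext hp.1
    constructor <;> (show eval p.rep _ = 0; rw [eval_dirD, hg, dotProduct_zero])
  have hbez : ∀ i j : Fin 3, i ≠ j →
      (zeroSet (dirD F (a i)) (dirD F (a j)) \ nodes F).Finite ∧
      (zeroSet (dirD F (a i)) (dirD F (a j)) \ nodes F).ncard =
        (d - 1) ^ 2 - (nodes F).ncard := by
    intro i j hij
    obtain ⟨h1, h2⟩ := bezout (show 1 ≤ d - 1 by omega) (dirD_hom hF (a i)) (dirD_hom hF (a j))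
      (transv_dir hd hF hnodal hq ha hb hij)
    refine ⟨h1.subset Set.diff_subset, ?_⟩
    rw [Set.ncard_diff (hsub i j) hfin, h2]
  have hpos : 0 < (d - 1) ^ 2 - (nodes F).ncard := by
    have h1 := Nat.choose_le_pow (d - 1) 2
    have h2 : 0 < (d - 1) ^ 2 := pow_pos (by omega) 2
    omega
  refine ⟨fun i => dirD F (a i), hmem, ?_, ?_, ?_⟩
  · rw [Fintype.linearIndependent_iff]
    intro c hc k
    obtain ⟨i, j, hij, hk⟩ : ∃ i j : Fin 3, i ≠ j ∧ ∀ l, l = i ∨ l = j ∨ l = k := by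
      revert k
      decide
    obtain ⟨hSf, hSc⟩ := hbez i j hij
    obtain ⟨p, ⟨hp1, hp2⟩, hpn⟩ := (Set.ncard_pos hSf).1 (hSc ▸ hpos)
    have hg := grad_of_zero F hb hk hp1 hp2
    have hne : eval p.rep (dirD F (a k)) ≠ 0 := by
      intro h0
      rw [h0, zero_smul] at hg
      exact hpn (hnodal p fun i => congrFun hg i)
    have he := congrArg (eval p.rep) hc
    rw [map_sum, map_zero, Finset.sum_eq_single k ?_ (by simp), smul_eval] at he
    · exact (mul_eq_zero.1 he).resolve_right hne
    · intro b _ hbk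
      rw [smul_eval]
      rcases hk b with rfl | rfl | rfl
      · rw [show eval p.rep (dirD F (a b)) = 0 from hp1, mul_zero]
      · rw [show eval p.rep (dirD F (a b)) = 0 from hp2, mul_zero]
      · exact absurd rfl hbk
  · apply le_antisymm
    · rw [Submodule.span_le]
      rintro _ ⟨i, rfl⟩
      exact hmem i
    · have hall : ∀ l, pderiv l F ∈ Submodule.span ℂ (Set.range fun i => dirD F (a i)) := by
        intro l
        rw [pd_expand F hb l]
        exact Submodule.sum_mem _ fun k _ => Submodule.smul_mem _ _
          (Submodule.subset_span ⟨k, rfl⟩)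
      rw [Submodule.span_le]
      rintro _ (rfl | rfl | rfl)
      · exact hall 0
      · exact hall 1
      · exact hall 2
  · intro i j hij
    obtain ⟨hSf, hSc⟩ := hbez i j hij
    exact ⟨_, hSf, hSc, Set.disjoint_sdiff_left, (Set.union_diff_cancel (hsub i j)).symm⟩

end
end
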